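/- (Boundary clustering under strong balance) Assume G is connected, E_neg is nonempty, p_ij + p_ji > 0 for every {i,j} ∈ E, and G is strongly balanced under the partition V = V₁ ∪ V₂ with both induced subgraphs G_{V₁} and G_{V₂} connected. Fix α ∈ (0,1) with α ≠ 1/2. Then there exists β₀ > 0 such that for every β > β₀ and every deterministic initial vector x⁰ ∈ [−A,A]ⁿ with 𝔛(0) > 0, under the constrained asymmetric belief process there exist random variables B₁ and B₂, each taking values in {−A, A}, such that ℙ( lim_{k→∞} x_i(k) = B₁ for all i ∈ V₁, and lim_{k→∞} x_i(k) = B₂ for all i ∈ V₂ ) = 1; moreover B₁ + B₂ = 0 almost surely. -/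

import Mathlib

open Matrix MeasureTheory Filter
open scoped ENNReal

noncomputable section

namespace SignedOpinion

/-- The vector `e i - e j` in `ℝⁿ`. -/
def esub {n : ℕ} (i j : Fin n) : Fin n → ℝ :=
  fun k => (if k = i then (1 : ℝ) else 0) - (if k = j then (1 : ℝ) else 0)

/-- The rank-one matrix `(e i - e j) (e i - e j)ᵀ`. -/
def dmatAux {n : ℕ} (i j : Fin n) : Matrix (Fin n) (Fin n) ℝ :=
  Matrix.vecMulVec (esub i j) (esub i j)

lemma dmatAux_symm {n : ℕ} (i j : Fin n) : dmatAux i j = dmatAux j i := by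
  ext a b
  simp only [dmatAux, esub, Matrix.vecMulVec_apply]
  ring

/-- `(e i - e j)(e i - e j)ᵀ` as a function of the unordered pair `{i, j}`. -/
def dmat {n : ℕ} : Sym2 (Fin n) → Matrix (Fin n) (Fin n) ℝ :=
  Sym2.lift ⟨dmatAux, dmatAux_symm⟩

/-- The averaging matrix `U = 𝟙𝟙ᵀ / n`. -/
def Umat (n : ℕ) : Matrix (Fin n) (Fin n) ℝ :=
  (n : ℝ)⁻¹ • Matrix.of (fun _ _ => (1 : ℝ))

/-- The positive update matrix `W⁺_{ij} = I - α (e i - e j)(e i - e j)ᵀ`. -/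
def Wpos {n : ℕ} (α : ℝ) (e : Sym2 (Fin n)) : Matrix (Fin n) (Fin n) ℝ :=
  1 - α • dmat e

/-- The negative update matrix `W⁻_{ij} = I + β (e i - e j)(e i - e j)ᵀ`. -/
def Wneg {n : ℕ} (β : ℝ) (e : Sym2 (Fin n)) : Matrix (Fin n) (Fin n) ℝ :=
  1 + β • dmat e

/-- The edge selection probability `μ({i,j}) = (p i j + p j i) / n`. -/
def edgeWeight {n : ℕ} (P : Matrix (Fin n) (Fin n) ℝ) : Sym2 (Fin n) → ℝ :=
  Sym2.lift ⟨fun i j => (P i j + P j i) / n, fun i j => by show (P i j + P j i) / n = (P j i + P i j) / n; rw [add_comm (P i j)]⟩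

/-- The weighted Laplacian of the graph on `Fin n` with edge set `Es`,
with weight `edgeWeight P e` on the edge `e`. -/
def lap {n : ℕ} (P : Matrix (Fin n) (Fin n) ℝ) (Es : Finset (Sym2 (Fin n))) :
    Matrix (Fin n) (Fin n) ℝ :=
  ∑ e ∈ Es, edgeWeight P e • dmat e

/-- The unit-weight (standard) Laplacian of the graph with edge set `Es`. -/
def lapStd {n : ℕ} (Es : Finset (Sym2 (Fin n))) : Matrix (Fin n) (Fin n) ℝ :=
  ∑ e ∈ Es, dmat e

/-- Largest (real) eigenvalue of a matrix. For a real symmetric matrix this is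
`λ_max`. -/
def lamMax {n : ℕ} (M : Matrix (Fin n) (Fin n) ℝ) : ℝ :=
  sSup {t : ℝ | ∃ v : Fin n → ℝ, v ≠ 0 ∧ M *ᵥ v = t • v}

/-- Smallest (real) eigenvalue of a matrix. -/
def lamMin {n : ℕ} (M : Matrix (Fin n) (Fin n) ℝ) : ℝ :=
  sInf {t : ℝ | ∃ v : Fin n → ℝ, v ≠ 0 ∧ M *ᵥ v = t • v}

/-- Second smallest eigenvalue of a (connected-graph) Laplacian: the smallest
eigenvalue attained by an eigenvector orthogonal to the all-ones vector. -/
def lam2 {n : ℕ} (M : Matrix (Fin n) (Fin n) ℝ) : ℝ :=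
  sInf {t : ℝ | ∃ v : Fin n → ℝ, v ≠ 0 ∧ (∑ i, v i = 0) ∧ M *ᵥ v = t • v}

/-- `P` is row-stochastic. -/
def RowStochastic {n : ℕ} (P : Matrix (Fin n) (Fin n) ℝ) : Prop :=
  (∀ i j, 0 ≤ P i j) ∧ ∀ i, ∑ j, P i j = 1

/-- `P` complies with the graph with edge set `E`. -/
def Complies {n : ℕ} (P : Matrix (Fin n) (Fin n) ℝ) (E : Finset (Sym2 (Fin n))) : Prop :=
  ∀ i j : Fin n, i ≠ j → 0 < P i j → s(i, j) ∈ E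

/-- The simple graph on `Fin n` with edge set `E`. -/
def graphOf {n : ℕ} (E : Finset (Sym2 (Fin n))) : SimpleGraph (Fin n) :=
  SimpleGraph.fromEdgeSet (↑E)

/-- `diam x = max_i x i - min_i x i`  (the quantity `𝔛` of the paper). -/
def diam {n : ℕ} (x : Fin n → ℝ) : ℝ := (⨆ i, x i) - ⨅ i, x i

/-- Selection alphabet `E ∪ {∗}` : an unordered node pair, or no selection. -/
abbrev Sel (n : ℕ) := Option (Sym2 (Fin n))

instance (n : ℕ) : MeasurableSpace (Sel n) := ⊤

/-- The update matrix triggered by a selection. -/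
def Wsel {n : ℕ} (α β : ℝ) (Epst Eneg : Finset (Sym2 (Fin n))) :
    Sel n → Matrix (Fin n) (Fin n) ℝ
  | none => 1
  | some e => if e ∈ Epst then Wpos α e else if e ∈ Eneg then Wneg β e else 1

/-- The belief process `x(k)` driven by the selection sequence `ω`. -/
def xproc {n : ℕ} (α β : ℝ) (Epst Eneg : Finset (Sym2 (Fin n))) (x0 : Fin n → ℝ)
    (ω : ℕ → Sel n) : ℕ → Fin n → ℝ
  | 0 => x0
  | k + 1 => Wsel α β Epst Eneg (ω k) *ᵥ xproc α β Epst Eneg x0 ω k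

/-- The matrix product `W(k) W(k-1) ⋯ W(0)`. -/
def Wprod {n : ℕ} (α β : ℝ) (Epst Eneg : Finset (Sym2 (Fin n))) (ω : ℕ → Sel n) :
    ℕ → Matrix (Fin n) (Fin n) ℝ
  | 0 => Wsel α β Epst Eneg (ω 0)
  | k + 1 => Wsel α β Epst Eneg (ω (k + 1)) * Wprod α β Epst Eneg ω k

/-- The one-step selection distribution `μ` on `E ∪ {∗}`. -/
def seldist {n : ℕ} (P : Matrix (Fin n) (Fin n) ℝ) (E : Finset (Sym2 (Fin n))) :
    Sel n → ℝ≥0∞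
  | none => ENNReal.ofReal (1 - ∑ e ∈ E, edgeWeight P e)
  | some e => if e ∈ E then ENNReal.ofReal (edgeWeight P e) else 0

/-- `ℙ` is the infinite product of `seldist P E`: the coordinates are i.i.d.
with per-coordinate distribution `seldist P E` (characterized on cylinders). -/
def IsIIDSel {n : ℕ} (ℙ : Measure (ℕ → Sel n)) (P : Matrix (Fin n) (Fin n) ℝ)
    (E : Finset (Sym2 (Fin n))) : Prop :=
  ∀ (K : Finset ℕ) (v : ℕ → Sel n),
    ℙ {ω | ∀ k ∈ K, ω k = v k} = ∏ k ∈ K, seldist P E (v k)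

/-- Selection alphabet for the asymmetric constrained model:
an ordered node pair (or `∗`), together with a tag in `{1,2,3}`. -/
abbrev Sel2 (n : ℕ) := Option (Fin n × Fin n) × Fin 3

instance (n : ℕ) : MeasurableSpace (Sel2 n) := ⊤

/-- weights `a, b, c` on the tags. -/
def wabc (a b c : ℝ) : Fin 3 → ℝ := ![a, b, c]

/-- Per-step distribution for the asymmetric constrained model: the pair
`({i,j}, t)` (represented by its ordered representative with `i < j`) has mass
`(wabc a b c t) · μ({i,j})`, and `(∗, t)` has mass `(wabc a b c t) · μ(∗)`. -/
def seldist2 {n : ℕ} (P : Matrix (Fin n) (Fin n) ℝ) (E : Finset (Sym2 (Fin n)))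
    (a b c : ℝ) : Sel2 n → ℝ≥0∞
  | (none, t) => ENNReal.ofReal (wabc a b c t) * ENNReal.ofReal (1 - ∑ e ∈ E, edgeWeight P e)
  | (some (i, j), t) =>
      if i < j ∧ s(i, j) ∈ E then
        ENNReal.ofReal (wabc a b c t) * ENNReal.ofReal (edgeWeight P s(i, j))
      else 0

/-- `ℙ` is the infinite product of `seldist2 P E a b c`. -/
def IsIIDSel2 {n : ℕ} (ℙ : Measure (ℕ → Sel2 n)) (P : Matrix (Fin n) (Fin n) ℝ)
    (E : Finset (Sym2 (Fin n))) (a b c : ℝ) : Prop :=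
  ∀ (K : Finset ℕ) (v : ℕ → Sel2 n),
    ℙ {ω | ∀ k ∈ K, ω k = v k} = ∏ k ∈ K, seldist2 P E a b c (v k)

/-- Projection onto `[-A, A]`. -/
def projA (A z : ℝ) : ℝ := max (-A) (min A z)

/-- `θ(e) = α` on positive edges, `-β` on negative edges. -/
def theta {n : ℕ} (α β : ℝ) (Epst Eneg : Finset (Sym2 (Fin n))) (e : Sym2 (Fin n)) : ℝ :=
  if e ∈ Epst then α else if e ∈ Eneg then -β else 0

/-- One step of the asymmetric constrained update. -/
def cstep {n : ℕ} (α β A : ℝ) (Epst Eneg : Finset (Sym2 (Fin n))) :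
    Sel2 n → (Fin n → ℝ) → (Fin n → ℝ)
  | (none, _), x => x
  | (some (i, j), t), x =>
      if t = 0 then
        Function.update x i
          (projA A ((1 - theta α β Epst Eneg s(i, j)) * x i + theta α β Epst Eneg s(i, j) * x j))
      else if t = 1 then
        Function.update x j
          (projA A ((1 - theta α β Epst Eneg s(i, j)) * x j + theta α β Epst Eneg s(i, j) * x i))
      else
        Function.update
          (Function.update x i
            (projA A ((1 - theta α β Epst Eneg s(i, j)) * x i + theta α β Epst Eneg s(i, j) * x j)))
          j
          (projA A ((1 - theta α β Epst Eneg s(i, j)) * x j + theta α β Epst Eneg s(i, j) * x i))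

/-- The constrained asymmetric belief process. -/
def cproc {n : ℕ} (α β A : ℝ) (Epst Eneg : Finset (Sym2 (Fin n))) (x0 : Fin n → ℝ)
    (ω : ℕ → Sel2 n) : ℕ → Fin n → ℝ
  | 0 => x0
  | k + 1 => cstep α β A Epst Eneg (ω k) (cproc α β A Epst Eneg x0 ω k)


section MarkovChain

variable {S X : Type*} {step : S → X → X} {supp : S → Prop}

/-- `y` is reached from `x` by at most `N` updates with letters satisfying `supp`. -/
inductive ReachIn (step : S → X → X) (supp : S → Prop) : ℕ → X → X → Prop
  | refl (N : ℕ) (x : X) : ReachIn step supp N x x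
  | head {N : ℕ} {x y : X} {s : S} (hs : supp s) (h : ReachIn step supp N (step s x) y) :
      ReachIn step supp (N + 1) x y

lemma ReachIn.mono {N M : ℕ} {x y : X} (h : ReachIn step supp N x y) (hNM : N ≤ M) :
    ReachIn step supp M x y := by
  induction h generalizing M with
  | refl N x => exact .refl M x
  | head hs _ ih =>
    obtain ⟨M, rfl⟩ : ∃ M', M = M' + 1 := ⟨M - 1, by omega⟩
    exact .head hs (ih (by omega))

lemma ReachIn.trans {N M : ℕ} {x y z : X} (h : ReachIn step supp N x y)
    (h' : ReachIn step supp M y z) : ReachIn step supp (N + M) x z := by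
  induction h with
  | refl N x => exact h'.mono (by omega)
  | head hs _ ih => exact (ReachIn.head hs (ih h')).mono (by omega)

lemma ReachIn.single {s : S} (hs : supp s) (x : X) : ReachIn step supp 1 x (step s x) :=
  .head hs (.refl 0 _)

/-- The state reached from `x` by successively applying the letters of `v`. -/
def runWord (step : S → X → X) : (m : ℕ) → (Fin m → S) → X → X
  | 0, _, x => x
  | m + 1, v, x => runWord step m (Fin.tail v) (step (v 0) x)

lemma runWord_preserves {I : X → Prop} (hI : ∀ s x, I x → I (step s x)) (m : ℕ) (v : Fin m → S) {x : X}
    (hx : I x) : I (runWord step m v x) := by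
  induction m generalizing x with
  | zero => exact hx
  | succ m ih => exact ih _ (hI _ _ hx)

variable [Fintype S]

/-- Expectation of `F` after `t` steps of the chain applying i.i.d. updates of law `w`. -/
def expect (w : S → ℝ) (step : S → X → X) (F : X → ℝ) : ℕ → X → ℝ
  | 0, x => F x
  | t + 1, x => ∑ s, w s * expect w step F t (step s x)

variable {w : S → ℝ} {I : X → Prop} {F G : X → ℝ}

lemma expect_add (t k : ℕ) (x : X) :
    expect w step F (t + k) x = expect w step (expect w step F k) t x := by
  induction t generalizing x with
  | zero => simp [expect]
  | succ t ih => rw [Nat.add_right_comm]; simp [expect, ih]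

lemma expect_mono (hw : ∀ s, 0 ≤ w s) (hI : ∀ s x, I x → I (step s x))
    (hFG : ∀ x, I x → F x ≤ G x) (t : ℕ) {x : X} (hx : I x) :
    expect w step F t x ≤ expect w step G t x := by
  induction t generalizing x with
  | zero => exact hFG x hx
  | succ t ih =>
    exact Finset.sum_le_sum fun s _ => mul_le_mul_of_nonneg_left (ih (hI s x hx)) (hw s)

lemma expect_const_mul (r : ℝ) (t : ℕ) (x : X) :
    expect w step (fun y => r * F y) t x = r * expect w step F t x := by
  induction t generalizing x with
  | zero => rfl
  | succ t ih =>
    simp only [expect, ih, Finset.mul_sum]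
    exact Finset.sum_congr rfl fun s _ => by ring

lemma expect_le_pow (hw : ∀ s, 0 ≤ w s) (hw1 : ∑ s, w s = 1)
    (hI : ∀ s x, I x → I (step s x)) {C : ℝ} (hC : 0 ≤ C)
    (hF : ∀ s x, I x → F (step s x) ≤ C * F x) (t : ℕ) {x : X} (hx : I x) :
    expect w step F t x ≤ C ^ t * F x := by
  induction t generalizing x with
  | zero => simp [expect]
  | succ t ih =>
    calc expect w step F (t + 1) x ≤ ∑ s, w s * (C ^ t * (C * F x)) :=
          Finset.sum_le_sum fun s _ => mul_le_mul_of_nonneg_left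
            ((ih (hI s x hx)).trans (by have := hF s x hx; gcongr)) (hw s)
      _ = C ^ (t + 1) * F x := by rw [← Finset.sum_mul, hw1]; ring

lemma expect_le_of_reachIn (hw : ∀ s, 0 ≤ w s) (hw1 : ∑ s, w s = 1)
    (hI : ∀ s x, I x → I (step s x)) {C : ℝ} (hC : 1 ≤ C)
    (hF : ∀ s x, I x → F (step s x) ≤ C * F x) {p : ℝ} (hp : 0 ≤ p) (hp1 : p ≤ 1)
    (hpw : ∀ s, supp s → p ≤ w s) {η : ℝ} (hη0 : 0 ≤ η) (hη : η ≤ 1) {N : ℕ} {x y : X}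
    (h : ReachIn step supp N x y) {t : ℕ} (ht : N ≤ t) (hx : I x) {M : ℝ} (hM : 0 ≤ M)
    (hxM : F x ≤ M) (hyM : F y ≤ η * M) :
    expect w step F t x ≤ C ^ t * M * (1 - p ^ N * (1 - η)) := by
  classical
  have hC0 : 0 ≤ C := by linarith
  induction h generalizing t M with
  | refl N x =>
    calc expect w step F t x ≤ C ^ t * F x := expect_le_pow hw hw1 hI hC0 hF t hx
      _ ≤ C ^ t * (η * M) := by gcongr
      _ = C ^ t * M * η := by ring
      _ ≤ _ := by
        have : p ^ N ≤ 1 := pow_le_one₀ hp hp1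
        gcongr
        nlinarith
  | @head N x y s hs h ih =>
    obtain ⟨t, rfl⟩ : ∃ t', t = t' + 1 := ⟨t - 1, by omega⟩
    have hother : ∀ s', F (step s' x) ≤ C * M := fun s' =>
      (hF s' x hx).trans (by gcongr)
    have hle : ∀ s', expect w step F t (step s' x) ≤ C ^ (t + 1) * M := fun s' =>
      (expect_le_pow hw hw1 hI hC0 hF t (hI s' x hx)).trans (by
        rw [pow_succ, mul_assoc]; have := hother s'; gcongr)
    have hgood := ih (t := t) (M := C * M) (by omega) (hI s x hx) (by positivity) (hother s)
      (hyM.trans (by gcongr; nlinarith))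
    have hsum : expect w step F (t + 1) x ≤
        ∑ s', (w s' * (C ^ (t + 1) * M) -
          (if s' = s then w s * (C ^ (t + 1) * M * (p ^ N * (1 - η))) else 0)) := by
      refine Finset.sum_le_sum fun s' _ => ?_
      split_ifs with hss
      · subst hss
        calc _ ≤ _ := mul_le_mul_of_nonneg_left hgood (hw s')
          _ = _ := by ring
      · simpa using mul_le_mul_of_nonneg_left (hle s') (hw s')
    rw [Finset.sum_sub_distrib, ← Finset.sum_mul, hw1] at hsum
    simp only [Finset.sum_ite_eq', Finset.mem_univ, if_true] at hsum
    have hη' : 0 ≤ 1 - η := by linarith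
    have : p * (C ^ (t + 1) * M * (p ^ N * (1 - η))) ≤
        w s * (C ^ (t + 1) * M * (p ^ N * (1 - η))) := by
      have := hpw s hs
      gcongr
    refine hsum.trans ?_
    rw [pow_succ p]
    linarith

/-- A nonnegative function that grows by a factor at most `C` in each step, and can be shrunk by
a factor `η` within `T` steps of positive probability, decays geometrically in mean. -/
lemma expect_le_geometric (hw : ∀ s, 0 ≤ w s) (hw1 : ∑ s, w s = 1)
    (hI : ∀ s x, I x → I (step s x)) (hF0 : ∀ x, I x → 0 ≤ F x) {C : ℝ} (hC : 1 ≤ C)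
    (hF : ∀ s x, I x → F (step s x) ≤ C * F x) {p : ℝ} (hp : 0 ≤ p) (hp1 : p ≤ 1)
    (hpw : ∀ s, supp s → p ≤ w s) {η : ℝ} (hη0 : 0 ≤ η) (hη : η ≤ 1) {T : ℕ}
    (hreach : ∀ x, I x → ∃ y, ReachIn step supp T x y ∧ F y ≤ η * F x) (k : ℕ) {x : X}
    (hx : I x) :
    expect w step F (k * T) x ≤ (C ^ T * (1 - p ^ T * (1 - η))) ^ k * F x := by
  have hρ : 0 ≤ C ^ T * (1 - p ^ T * (1 - η)) := by
    have : p ^ T ≤ 1 := pow_le_one₀ hp hp1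
    have : 0 ≤ p ^ T := by positivity
    have : 0 ≤ C ^ T := by positivity
    exact mul_nonneg this (by nlinarith)
  induction k generalizing x with
  | zero => simp [expect]
  | succ k ih =>
    rw [Nat.succ_mul, expect_add]
    calc _ ≤ expect w step (fun y => C ^ T * (1 - p ^ T * (1 - η)) * F y) (k * T) x :=
          expect_mono hw hI (fun y hy => by
            obtain ⟨z, hz, hzF⟩ := hreach y hy
            exact (expect_le_of_reachIn hw hw1 hI hC hF hp hp1 hpw hη0 hη hz le_rfl hy
              (hF0 y hy) le_rfl hzF).trans (le_of_eq (by ring))) _ hx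
      _ = C ^ T * (1 - p ^ T * (1 - η)) * expect w step F (k * T) x := expect_const_mul _ _ _
      _ ≤ C ^ T * (1 - p ^ T * (1 - η)) * ((C ^ T * (1 - p ^ T * (1 - η))) ^ k * F x) := by
          have := ih hx
          gcongr
      _ = _ := by ring

lemma expect_eq_sum (m : ℕ) (x : X) :
    expect w step F m x = ∑ v : Fin m → S, (∏ i, w (v i)) * F (runWord step m v x) := by
  induction m generalizing x with
  | zero => simp [expect, runWord]
  | succ m ih =>
    rw [← (Fin.consEquiv fun _ => S).sum_comp, Fintype.sum_prod_type]
    simp only [expect, ih, Finset.mul_sum]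
    refine Finset.sum_congr rfl fun s _ => Finset.sum_congr rfl fun v _ => ?_
    simp [Fin.consEquiv, Fin.prod_univ_succ, runWord, mul_assoc]

end MarkovChain
section Projection

variable {A z : ℝ}

lemma projA_mem (hA : 0 ≤ A) (z : ℝ) : projA A z ∈ Set.Icc (-A) A :=
  ⟨le_max_left _ _, max_le (by linarith) (min_le_left _ _)⟩

lemma projA_of_mem (h : z ∈ Set.Icc (-A) A) : projA A z = z := by
  rw [projA, min_eq_right h.2, max_eq_right h.1]

lemma projA_of_ge (hA : 0 ≤ A) (h : A ≤ z) : projA A z = A := by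
  rw [projA, min_eq_left h, max_eq_right (by linarith)]

lemma projA_of_le (hA : 0 ≤ A) (h : z ≤ -A) : projA A z = -A := by
  rw [projA, min_eq_right (by linarith), max_eq_left h]

lemma projA_mono : Monotone (projA A) := fun _ _ h =>
  max_le_max le_rfl (min_le_min le_rfl h)

lemma projA_neg (hA : 0 ≤ A) (z : ℝ) : projA A (-z) = -projA A z := by
  simp only [projA, max_def, min_def]
  split_ifs <;> linarith

lemma mul_projA (hA : 0 ≤ A) {σ : ℝ} (hσ : σ = 1 ∨ σ = -1) (z : ℝ) :
    σ * projA A z = projA A (σ * z) := by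
  rcases hσ with rfl | rfl
  · simp
  · simp [projA_neg hA]

end Projection

section OneStep

variable {n : ℕ} {Epst Eneg : Finset (Sym2 (Fin n))} {α β A : ℝ}

/-- All beliefs lie in `[-A, A]`. -/
def InBox (A : ℝ) (x : Fin n → ℝ) : Prop := ∀ i, x i ∈ Set.Icc (-A) A

lemma InBox.convex_mem {x : Fin n → ℝ} (hx : InBox A x) (hα0 : 0 ≤ α) (hα1 : α ≤ 1)
    (i j : Fin n) : (1 - α) * x i + α * x j ∈ Set.Icc (-A) A := by
  obtain ⟨h1, h2⟩ := hx i
  obtain ⟨h3, h4⟩ := hx j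
  constructor <;> nlinarith

lemma InBox.update {x : Fin n → ℝ} (hx : InBox A x) (i : Fin n) {z : ℝ}
    (hz : z ∈ Set.Icc (-A) A) : InBox A (Function.update x i z) := by
  intro k
  rcases eq_or_ne k i with rfl | hk
  · simpa using hz
  · simpa [hk] using hx k

lemma theta_of_mem_pos {e : Sym2 (Fin n)} (he : e ∈ Epst) : theta α β Epst Eneg e = α := by
  simp [theta, he]

lemma theta_of_mem_neg (hdisj : Disjoint Epst Eneg) {e : Sym2 (Fin n)} (he : e ∈ Eneg) :
    theta α β Epst Eneg e = -β := by
  simp [theta, he, Finset.disjoint_right.mp hdisj he]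

lemma theta_of_notMem {e : Sym2 (Fin n)} (he : e ∉ Epst ∪ Eneg) :
    theta α β Epst Eneg e = 0 := by
  rw [Finset.mem_union, not_or] at he
  simp [theta, he.1, he.2]

/-- A letter of the selection alphabet acts as the identity, as an averaging along a positive
edge, or as a clipped repulsion along a negative edge. -/
lemma cstep_cases (hdisj : Disjoint Epst Eneg) (hne : ∀ i j, s(i, j) ∈ Epst ∪ Eneg → i ≠ j)
    (hα0 : 0 ≤ α) (hα1 : α ≤ 1) {x : Fin n → ℝ} (hx : InBox A x) (l : Sel2 n) :
    cstep α β A Epst Eneg l x = x ∨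
    (∃ i j, i ≠ j ∧ s(i, j) ∈ Epst ∧
      (cstep α β A Epst Eneg l x = Function.update x i ((1 - α) * x i + α * x j) ∨
       cstep α β A Epst Eneg l x =
        Function.update (Function.update x i ((1 - α) * x i + α * x j)) j
          ((1 - α) * x j + α * x i))) ∨
    (∃ i j, i ≠ j ∧ s(i, j) ∈ Eneg ∧
      (cstep α β A Epst Eneg l x = Function.update x i (projA A (x i + β * (x i - x j))) ∨
       cstep α β A Epst Eneg l x =
        Function.update (Function.update x i (projA A (x i + β * (x i - x j)))) j
          (projA A (x j + β * (x j - x i))))) := by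
  obtain ⟨_ | ⟨i, j⟩, t⟩ := l
  · exact Or.inl rfl
  by_cases he : s(i, j) ∈ Epst ∪ Eneg
  · have hij := hne i j he
    right
    rcases Finset.mem_union.mp he with hp | hn
    · left
      have hθ := theta_of_mem_pos (α := α) (β := β) (Eneg := Eneg) hp
      simp only [cstep, hθ, projA_of_mem (hx.convex_mem hα0 hα1 _ _)]
      split_ifs
      · exact ⟨i, j, hij, hp, Or.inl rfl⟩
      · exact ⟨j, i, hij.symm, by rwa [Sym2.eq_swap], Or.inl rfl⟩
      · exact ⟨i, j, hij, hp, Or.inr rfl⟩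
    · right
      have hθ := theta_of_mem_neg (α := α) (β := β) hdisj hn
      have hr : ∀ a b : ℝ, (1 - -β) * a + -β * b = a + β * (a - b) := fun a b => by ring
      simp only [cstep, hθ, hr]
      split_ifs
      · exact ⟨i, j, hij, hn, Or.inl rfl⟩
      · exact ⟨j, i, hij.symm, by rwa [Sym2.eq_swap], Or.inl rfl⟩
      · exact ⟨i, j, hij, hn, Or.inr rfl⟩
  · left
    have hθ := theta_of_notMem (α := α) (β := β) he
    simp [cstep, hθ, projA_of_mem (hx _)]

lemma cstep_apply (hdisj : Disjoint Epst Eneg) (hne : ∀ i j, s(i, j) ∈ Epst ∪ Eneg → i ≠ j)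
    (hα0 : 0 ≤ α) (hα1 : α ≤ 1) {x : Fin n → ℝ} (hx : InBox A x) (l : Sel2 n) (k : Fin n) :
    cstep α β A Epst Eneg l x k = x k ∨
    (∃ m, s(k, m) ∈ Epst ∧ cstep α β A Epst Eneg l x k = (1 - α) * x k + α * x m) ∨
    (∃ m, s(k, m) ∈ Eneg ∧
      cstep α β A Epst Eneg l x k = projA A (x k + β * (x k - x m))) := by
  have hsw : ∀ i j : Fin n, s(i, j) = s(j, i) := fun i j => Sym2.eq_swap
  rcases cstep_cases (β := β) hdisj hne hα0 hα1 hx l with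
    h | ⟨i, j, hij, he, h | h⟩ | ⟨i, j, hij, he, h | h⟩ <;> rw [h]
  · exact Or.inl rfl
  all_goals
    by_cases hki : k = i
    · subst hki
      first
        | exact Or.inr (Or.inl ⟨j, he, by simp [hij]⟩)
        | exact Or.inr (Or.inr ⟨j, he, by simp [hij]⟩)
    by_cases hkj : k = j
    · subst hkj
      first
        | (refine Or.inl ?_; simp [hki]; done)
        | exact Or.inr (Or.inl ⟨i, hsw i k ▸ he, by simp⟩)
        | exact Or.inr (Or.inr ⟨i, hsw i k ▸ he, by simp⟩)
    · exact Or.inl (by simp [hki, hkj])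

lemma InBox.cstep (hA : 0 ≤ A) (hdisj : Disjoint Epst Eneg)
    (hne : ∀ i j, s(i, j) ∈ Epst ∪ Eneg → i ≠ j)
    (hα0 : 0 ≤ α) (hα1 : α ≤ 1) {x : Fin n → ℝ} (hx : InBox A x) (l : Sel2 n) :
    InBox A (cstep α β A Epst Eneg l x) := by
  intro k
  rcases cstep_apply (β := β) hdisj hne hα0 hα1 hx l k with h | ⟨m, -, h⟩ | ⟨m, -, h⟩ <;> rw [h]
  · exact hx k
  · exact hx.convex_mem hα0 hα1 k m
  · exact projA_mem hA _

lemma sub_le_diam (x : Fin n → ℝ) (i j : Fin n) : x i - x j ≤ diam x :=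
  sub_le_sub (le_ciSup (Set.finite_range x).bddAbove i) (ciInf_le (Set.finite_range x).bddBelow j)

lemma exists_extremal_pair [NeZero n] (x : Fin n → ℝ) :
    ∃ p q, (∀ k, x k ≤ x p) ∧ (∀ k, x q ≤ x k) ∧ diam x = x p - x q := by
  obtain ⟨p, hp⟩ := exists_eq_ciSup_of_finite (f := x)
  obtain ⟨q, hq⟩ := exists_eq_ciInf_of_finite (f := x)
  refine ⟨p, q, fun k => ?_, fun k => ?_, by rw [diam, hp, hq]⟩
  · rw [hp]; exact le_ciSup (Set.finite_range x).bddAbove k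
  · rw [hq]; exact ciInf_le (Set.finite_range x).bddBelow k

lemma InBox.diam_le [NeZero n] {x : Fin n → ℝ} (hx : InBox A x) : diam x ≤ 2 * A := by
  obtain ⟨p, q, -, -, h⟩ := exists_extremal_pair x
  linarith [(hx p).2, (hx q).1]

/-- A single update shrinks the spread of the beliefs at most by the factor
`min (1 - α) |1 - 2 * α|`. -/
lemma diam_cstep_ge [NeZero n] (hdisj : Disjoint Epst Eneg)
    (hne : ∀ i j, s(i, j) ∈ Epst ∪ Eneg → i ≠ j)
    (hα0 : 0 ≤ α) (hα1 : α ≤ 1) (hβ : 0 ≤ β) {x : Fin n → ℝ} (hx : InBox A x) (l : Sel2 n) :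
    min (1 - α) |1 - 2 * α| * diam x ≤ diam (cstep α β A Epst Eneg l x) := by
  obtain ⟨p, q, hp, hq, hd⟩ := exists_extremal_pair x
  set c := min (1 - α) |1 - 2 * α| with hc
  have hc1 : c ≤ 1 - α := min_le_left _ _
  have hc2 : c ≤ |1 - 2 * α| := min_le_right _ _
  have hd0 : 0 ≤ x p - x q := sub_nonneg.mpr (hp q)
  have hcd1 : c * (x p - x q) ≤ (1 - α) * (x p - x q) := by gcongr
  have hcd2 : c * (x p - x q) ≤ |1 - 2 * α| * (x p - x q) := by gcongr
  have hcd3 : (1 - α) * (x p - x q) ≤ x p - x q := by nlinarith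
  set y := cstep α β A Epst Eneg l x with hy
  rw [hd]
  by_cases hpq : p = q
  · subst hpq; simpa using sub_le_diam y p p
  have hpq' : q ≠ p := Ne.symm hpq
  have key : ∀ a b, c * (x p - x q) ≤ y a - y b → c * (x p - x q) ≤ diam y :=
    fun a b h => h.trans (sub_le_diam y a b)
  rcases cstep_cases (β := β) hdisj hne hα0 hα1 hx l with
    h | ⟨i, j, hij, he, h | h⟩ | ⟨i, j, hij, he, h | h⟩
  · rw [← hy] at h
    exact key p q (by rw [h]; linarith)
  · rw [← hy] at h
    refine key p q ?_
    have hji := hij.symm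
    have h1 := hq j
    have h2 := hp j
    rw [h]
    by_cases hpi : p = i
    · subst hpi; simp [hpq']; nlinarith
    · by_cases hqi : q = i
      · subst hqi; simp [hpi]; nlinarith
      · simp [hpi, hqi]; linarith
  · rw [← hy] at h
    have hji := hij.symm
    have h1 := hq j
    have h2 := hp j
    have h3 := hq i
    have h4 := hp i
    have habs : ∀ a b, y a - y b = (1 - 2 * α) * (x p - x q) → c * (x p - x q) ≤ diam y := by
      intro a b hab
      rcases abs_cases (1 - 2 * α) with ⟨h, -⟩ | ⟨h, -⟩
      · exact key a b (by rw [hab, ← h]; exact hcd2)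
      · refine key b a ?_
        rw [h] at hcd2
        linarith
    by_cases hpi : p = i
    · subst hpi
      by_cases hqj : q = j
      · subst hqj
        exact habs p q (by rw [h]; simp [hpq]; ring)
      · refine key p q ?_
        rw [h]; simp [hpq', hij, hqj]; nlinarith
    by_cases hpj : p = j
    · subst hpj
      by_cases hqi : q = i
      · subst hqi
        exact habs p q (by rw [h]; simp [hpq']; ring)
      · refine key p q ?_
        rw [h]; simp [hpq', hqi]; nlinarith
    refine key p q ?_
    rw [h]
    by_cases hqi : q = i
    · subst hqi; simp [hpi, hpj, hij]; nlinarith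
    by_cases hqj : q = j
    · subst hqj; simp [hpi, hpj]; nlinarith
    simp [hpi, hpj, hqi, hqj]; linarith
  all_goals
    rw [← hy] at h
    refine key p q ?_
    have hup : ∀ m, x p ≤ projA A (x p + β * (x p - x m)) := fun m => by
      have hm : 0 ≤ x p - x m := sub_nonneg.mpr (hp m)
      have := projA_mono (A := A) (a := x p) (b := x p + β * (x p - x m)) (by nlinarith)
      rwa [projA_of_mem (hx p)] at this
    have hdn : ∀ m, projA A (x q + β * (x q - x m)) ≤ x q := fun m => by
      have hm : x q - x m ≤ 0 := sub_nonpos.mpr (hq m)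
      have := projA_mono (A := A) (b := x q) (a := x q + β * (x q - x m)) (by nlinarith)
      rwa [projA_of_mem (hx q)] at this
    have hyp : x p ≤ y p := by
      rw [h]
      by_cases hpj : p = j
      · subst hpj; simp [hij.symm, hup]
      by_cases hpi : p = i
      · subst hpi; simp [hpj, hup]
      simp [hpi, hpj]
    have hyq : y q ≤ x q := by
      rw [h]
      by_cases hqj : q = j
      · subst hqj; simp [hij.symm, hdn]
      by_cases hqi : q = i
      · subst hqi; simp [hqj, hdn]
      simp [hqi, hqj]
    linarith

end OneStep
section Balance

variable {n : ℕ} {Epst Eneg : Finset (Sym2 (Fin n))} {α β A : ℝ} {s : Fin n → ℝ} {u w : Fin n}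

/-- The sign vector `s` encodes a strongly balanced bipartition, `{u, w}` is a negative edge, and
every node is joined to `u` or `w` by positive edges. -/
structure SignedBalance (Epst Eneg : Finset (Sym2 (Fin n))) (s : Fin n → ℝ) (u w : Fin n) :
    Prop where
  ne : ∀ i j, s(i, j) ∈ Epst ∪ Eneg → i ≠ j
  disj : Disjoint Epst Eneg
  sign : ∀ i, s i = 1 ∨ s i = -1
  pos : ∀ i j, s(i, j) ∈ Epst → s i = s j
  neg : ∀ i j, s(i, j) ∈ Eneg → s j = -s i
  edge : s(u, w) ∈ Eneg
  reach : ∀ v, Relation.ReflTransGen (fun a b => s(a, b) ∈ Epst) u v ∨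
    Relation.ReflTransGen (fun a b => s(a, b) ∈ Epst) w v

lemma SignedBalance.neg_sign (h : SignedBalance Epst Eneg s u w) :
    SignedBalance Epst Eneg (-s) u w where
  ne := h.ne
  disj := h.disj
  sign i := by rcases h.sign i with hi | hi <;> simp [hi]
  pos i j hij := by simp [h.pos i j hij]
  neg i j hij := by simp [h.neg i j hij]
  edge := h.edge
  reach := h.reach

lemma SignedBalance.edge_symm (h : SignedBalance Epst Eneg s u w) : s(w, u) ∈ Eneg := by
  rw [Sym2.eq_swap]; exact h.edge

lemma SignedBalance.ne_uw (h : SignedBalance Epst Eneg s u w) : u ≠ w :=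
  h.ne _ _ (Finset.mem_union_right _ h.edge)

lemma SignedBalance.sign_ne (h : SignedBalance Epst Eneg s u w) : s u ≠ s w := by
  have := h.neg _ _ h.edge
  rcases h.sign u with hu | hu <;> rw [this, hu] <;> norm_num

lemma SignedBalance.sign_eq (h : SignedBalance Epst Eneg s u w) {a b : Fin n}
    (hab : Relation.ReflTransGen (fun a b => s(a, b) ∈ Epst) a b) : s a = s b := by
  induction hab with
  | refl => rfl
  | tail _ hbc ih => exact ih.trans (h.pos _ _ hbc)

/-- All signed beliefs are at least `t`. -/
def Near (s : Fin n → ℝ) (t : ℝ) (x : Fin n → ℝ) : Prop := ∀ i, t ≤ s i * x i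

lemma Near.cstep (h : SignedBalance Epst Eneg s u w) (hA : 0 ≤ A) (hα0 : 0 ≤ α) (hα1 : α ≤ 1)
    (hβ : 0 ≤ β) {x : Fin n → ℝ} (hx : InBox A x) {t : ℝ} (ht : 0 ≤ t) (hN : Near s t x)
    (l : Sel2 n) : Near s t (cstep α β A Epst Eneg l x) := by
  intro k
  rcases cstep_apply (β := β) h.disj h.ne hα0 hα1 hx l k with h' | ⟨m, hm, h'⟩ | ⟨m, hm, h'⟩
  · rw [h']; exact hN k
  · rw [h']
    have h1 := hN k
    have h2 := hN m
    rw [← h.pos _ _ hm] at h2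
    nlinarith
  · rw [h', mul_projA hA (h.sign k)]
    have h1 := hN k
    have h2 := hN m
    rw [h.neg _ _ hm] at h2
    have hmem : s k * x k ∈ Set.Icc (-A) A := by
      rw [← projA_of_mem (hx k), mul_projA hA (h.sign k)]
      exact projA_mem hA _
    calc t ≤ s k * x k := h1
      _ = projA A (s k * x k) := (projA_of_mem hmem).symm
      _ ≤ _ := projA_mono (by nlinarith)

/-- The letter that updates `i` only, using its neighbour `j`. -/
def upd (i j : Fin n) : Sel2 n := if i < j then (some (i, j), 0) else (some (j, i), 1)

/-- The letters updating one endpoint of an edge. -/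
def IsUpd (Epst Eneg : Finset (Sym2 (Fin n))) (l : Sel2 n) : Prop :=
  ∃ i j, s(i, j) ∈ Epst ∪ Eneg ∧ l = upd i j

lemma cstep_upd (i j : Fin n) (x : Fin n → ℝ) :
    cstep α β A Epst Eneg (upd i j) x = Function.update x i
      (projA A ((1 - theta α β Epst Eneg s(i, j)) * x i + theta α β Epst Eneg s(i, j) * x j)) := by
  unfold upd
  split_ifs
  · simp [cstep]
  · simp [cstep, Sym2.eq_swap (a := j)]

/-- Reachability for the constrained process through one-sided updates. -/
abbrev CReach (α β A : ℝ) (Epst Eneg : Finset (Sym2 (Fin n))) :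
    ℕ → (Fin n → ℝ) → (Fin n → ℝ) → Prop :=
  ReachIn (cstep α β A Epst Eneg) (IsUpd Epst Eneg)

lemma cReach_pos {i j : Fin n} (hij : s(i, j) ∈ Epst) (hα0 : 0 ≤ α) (hα1 : α ≤ 1)
    {x : Fin n → ℝ} (hx : InBox A x) :
    CReach α β A Epst Eneg 1 x (Function.update x i ((1 - α) * x i + α * x j)) := by
  have := ReachIn.single (step := cstep α β A Epst Eneg) (supp := IsUpd Epst Eneg)
    (s := upd i j) ⟨i, j, Finset.mem_union_left _ hij, rfl⟩ x
  rwa [cstep_upd, theta_of_mem_pos hij, projA_of_mem (hx.convex_mem hα0 hα1 _ _)] at this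

lemma cReach_neg (hdisj : Disjoint Epst Eneg) {i j : Fin n} (hij : s(i, j) ∈ Eneg)
    (x : Fin n → ℝ) :
    CReach α β A Epst Eneg 1 x (Function.update x i (projA A (x i + β * (x i - x j)))) := by
  have := ReachIn.single (step := cstep α β A Epst Eneg) (supp := IsUpd Epst Eneg)
    (s := upd i j) ⟨i, j, Finset.mem_union_right _ hij, rfl⟩ x
  rw [cstep_upd, theta_of_mem_neg hdisj hij] at this
  convert this using 3
  ring

/-- A discrepancy between `v` and a reference node of the other side is transported along
positive edges, at the cost of a fixed factor. -/
lemma SignedBalance.transport (h : SignedBalance Epst Eneg s u w) (hα0 : 0 < α) (hα1 : α ≤ 1)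
    {v z r : Fin n} (hvz : Relation.ReflTransGen (fun a b => s(a, b) ∈ Epst) v z)
    (hr : s r ≠ s z) :
    ∃ N : ℕ, ∀ β (x : Fin n → ℝ) (ε : ℝ), InBox A x → (2 / α) ^ N * ε ≤ |x v - x r| →
      ∃ y, CReach α β A Epst Eneg N x y ∧ InBox A y ∧ y r = x r ∧ ε ≤ |y z - x r| := by
  induction hvz using Relation.ReflTransGen.head_induction_on with
  | refl => exact ⟨0, fun β x ε hx hε => ⟨x, .refl _ _, hx, rfl, by simpa using hε⟩⟩
  | @head v v' hvv' hv'z ih =>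
    obtain ⟨N, ih⟩ := ih
    refine ⟨N + 1, fun β x ε hx hε => ?_⟩
    by_cases hbig : (2 / α) ^ N * ε ≤ |x v' - x r|
    · obtain ⟨y, h1, h2⟩ := ih β x ε hx hbig
      exact ⟨y, h1.mono (by omega), h2⟩
    · have hrv' : r ≠ v' := by
        rintro rfl
        exact hr (h.sign_eq hv'z)
      have hvv'' : s(v', v) ∈ Epst := by rwa [Sym2.eq_swap]
      set x' := Function.update x v' ((1 - α) * x v' + α * x v) with hx'
      have hxr : x' r = x r := by simp [hx', hrv']
      have hα' : α * ((2 / α) ^ (N + 1) * ε) = 2 * ((2 / α) ^ N * ε) := by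
        rw [pow_succ]; field_simp
      have hd : (2 / α) ^ N * ε ≤ |x' v' - x' r| := by
        rw [hxr]
        have e : x' v' - x r = α * (x v - x r) - (α - 1) * (x v' - x r) := by
          simp [hx']; ring
        have h1 : |α * (x v - x r)| = α * |x v - x r| := by rw [abs_mul, abs_of_pos hα0]
        have h2 : |(α - 1) * (x v' - x r)| = (1 - α) * |x v' - x r| := by
          rw [abs_mul, abs_of_nonpos (by linarith)]; ring
        have h3 := abs_sub_abs_le_abs_sub (α * (x v - x r)) ((α - 1) * (x v' - x r))
        rw [e]
        rw [h1, h2] at h3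
        push Not at hbig
        nlinarith [abs_nonneg (x v' - x r), mul_le_mul_of_nonneg_left hε hα0.le]
      obtain ⟨y, h1, h2, h3, h4⟩ := ih β x' ε (hx.update _ (hx.convex_mem hα0.le hα1 _ _)) hd
      refine ⟨y, ((cReach_pos hvv'' hα0.le hα1 hx).trans h1).mono (by omega), h2, ?_, ?_⟩
      · rw [h3, hxr]
      · rwa [hxr] at h4

/-- A discrepancy along a negative edge is amplified by `β`, unless both endpoints get pinned to
opposite boundary points. -/
lemma grow_or_pin (hdisj : Disjoint Epst Eneg) (hA : 0 ≤ A) (hβ : 0 ≤ β) {i j : Fin n}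
    (hne : i ≠ j) (hij : s(i, j) ∈ Eneg) {x : Fin n → ℝ} (hx : InBox A x) (hlt : x j ≤ x i) :
    ∃ y, CReach α β A Epst Eneg 2 x y ∧ InBox A y ∧
      (β * (x i - x j) ≤ y i - y j ∨ (y i = A ∧ y j = -A)) := by
  have hji : s(j, i) ∈ Eneg := by rwa [Sym2.eq_swap]
  set x' := Function.update x i (projA A (x i + β * (x i - x j))) with hx'
  have h1 : CReach α β A Epst Eneg 1 x x' := cReach_neg hdisj hij x
  have hb : InBox A x' := hx.update _ (projA_mem hA _)
  have hj : x' j = x j := by simp [hx', hne.symm]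
  have hβ' : 0 ≤ β * (x i - x j) := mul_nonneg hβ (by linarith)
  rcases le_total (x i + β * (x i - x j)) A with hle | hge
  · refine ⟨x', h1.mono (by norm_num), hb, Or.inl ?_⟩
    have hi : x' i = x i + β * (x i - x j) := by
      simp only [hx', Function.update_self]
      exact projA_of_mem ⟨by linarith [(hx i).1], hle⟩
    rw [hi, hj]; linarith
  have hi : x' i = A := by simp [hx', projA_of_ge hA hge]
  set x'' := Function.update x' j (projA A (x' j + β * (x' j - x' i))) with hx''
  have h2 : CReach α β A Epst Eneg 2 x x'' := h1.trans (cReach_neg hdisj hji x')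
  have hi' : x'' i = A := by simp [hx'', hne, hi]
  refine ⟨x'', h2, hb.update _ (projA_mem hA _), ?_⟩
  rcases le_total (x' j + β * (x' j - x' i)) (-A) with hle | hge'
  · exact Or.inr ⟨hi', by simp [hx'', projA_of_le hA hle]⟩
  · left
    have hxi := (hx i).2
    have hxj := (hx j).2
    have hj' : x'' j = x' j + β * (x' j - x' i) := by
      simp only [hx'', Function.update_self]
      exact projA_of_mem ⟨hge', by rw [hj, hi]; nlinarith⟩
    rw [hi', hj', hi, hj]
    nlinarith

/-- Both endpoints of the distinguished negative edge are at their boundary points. -/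
def Pinned (A : ℝ) (s : Fin n → ℝ) (u w : Fin n) (x : Fin n → ℝ) : Prop :=
  s u * x u = A ∧ s w * x w = A

lemma SignedBalance.spread_single (h : SignedBalance Epst Eneg s u w) (hα0 : 0 < α) (hα1 : α < 1)
    (v : Fin n) :
    ∃ N : ℕ, ∀ β (x : Fin n → ℝ) (t : ℝ), InBox A x → Pinned A s u w x → Near s t x →
      ∃ y, CReach α β A Epst Eneg N x y ∧ InBox A y ∧ Pinned A s u w y ∧
        (∀ i, min α (1 - α) ^ N * (s i * x i - t) ≤ s i * y i - t) ∧
        min α (1 - α) ^ N * (A - t) ≤ s v * y v - t := by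
  have hroot : ∀ v, v = u ∨ v = w → ∃ N : ℕ, ∀ β (x : Fin n → ℝ) (t : ℝ), InBox A x →
      Pinned A s u w x → Near s t x →
      ∃ y, CReach α β A Epst Eneg N x y ∧ InBox A y ∧ Pinned A s u w y ∧
        (∀ i, min α (1 - α) ^ N * (s i * x i - t) ≤ s i * y i - t) ∧
        min α (1 - α) ^ N * (A - t) ≤ s v * y v - t := by
    intro v hv
    refine ⟨0, fun β x t hx hp _ => ⟨x, .refl _ _, hx, hp, by simp, ?_⟩⟩
    rcases hv with rfl | rfl
    · simp [hp.1]
    · simp [hp.2]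
  obtain ⟨r, hr, hrv⟩ : ∃ r, (r = u ∨ r = w) ∧
      Relation.ReflTransGen (fun a b => s(a, b) ∈ Epst) r v := by
    rcases h.reach v with hv | hv
    · exact ⟨u, Or.inl rfl, hv⟩
    · exact ⟨w, Or.inr rfl, hv⟩
  induction hrv with
  | refl => exact hroot _ hr
  | @tail b d _ hbd ih =>
    by_cases hd : d = u ∨ d = w
    · exact hroot _ hd
    rw [not_or] at hd
    obtain ⟨N, ih⟩ := ih
    refine ⟨N + 1, fun β x t hx hp hN => ?_⟩
    obtain ⟨y, h1, h2, h3, h4, h5⟩ := ih β x t hx hp hN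
    have hdb : s(d, b) ∈ Epst := by rwa [Sym2.eq_swap]
    have hsd := h.pos _ _ hdb
    have hm0 : 0 < min α (1 - α) := lt_min hα0 (by linarith)
    have hmα : min α (1 - α) ≤ α := min_le_left _ _
    have hmα' : min α (1 - α) ≤ 1 - α := min_le_right _ _
    set m := min α (1 - α)
    have hm1 : m ≤ 1 := by linarith
    have hx0 : ∀ i, 0 ≤ s i * x i - t := fun i => sub_nonneg.mpr (hN i)
    have hy0 : ∀ i, 0 ≤ s i * y i - t := fun i =>
      (mul_nonneg (by positivity) (hx0 i)).trans (h4 i)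
    have hval : s d * ((1 - α) * y d + α * y b) - t =
        (1 - α) * (s d * y d - t) + α * (s b * y b - t) := by rw [← hsd]; ring
    refine ⟨Function.update y d ((1 - α) * y d + α * y b),
      h1.trans (cReach_pos hdb hα0.le hα1.le h2), h2.update _ (h2.convex_mem hα0.le hα1.le _ _),
      ?_, fun i => ?_, ?_⟩
    · simpa [Pinned, Ne.symm hd.1, Ne.symm hd.2] using h3
    · rw [pow_succ', mul_assoc]
      by_cases hi : i = d
      · subst hi
        rw [Function.update_self, hval]
        have := mul_nonneg hα0.le (hy0 b)
        calc _ ≤ (1 - α) * (s i * y i - t) := mul_le_mul hmα' (h4 i)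
              (mul_nonneg (by positivity) (hx0 i)) (by linarith)
          _ ≤ _ := by linarith
      · rw [Function.update_of_ne hi]
        calc _ ≤ 1 * (s i * y i - t) := mul_le_mul hm1 (h4 i)
              (mul_nonneg (by positivity) (hx0 i)) (by linarith)
          _ = _ := one_mul _
    · rw [Function.update_self, hval, pow_succ', mul_assoc]
      have hAt : 0 ≤ A - t := by have := hx0 u; rw [hp.1] at this; exact this
      have := mul_nonneg (by linarith : 0 ≤ 1 - α) (hy0 d)
      calc _ ≤ α * (s b * y b - t) := mul_le_mul hmα h5
            (mul_nonneg (by positivity) hAt) hα0.le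
        _ ≤ _ := by linarith

lemma SignedBalance.spread (h : SignedBalance Epst Eneg s u w) (hα0 : 0 < α) (hα1 : α < 1) :
    ∃ N : ℕ, ∀ β (x : Fin n → ℝ) (t : ℝ), InBox A x → Pinned A s u w x → Near s t x →
      ∃ y, CReach α β A Epst Eneg N x y ∧ InBox A y ∧ Pinned A s u w y ∧
        Near s (t + min α (1 - α) ^ N * (A - t)) y := by
  have hm0 : 0 < min α (1 - α) := lt_min hα0 (by linarith)
  have hm1 : min α (1 - α) ≤ 1 := (min_le_left _ _).trans hα1.le
  suffices H : ∀ V : Finset (Fin n), ∃ N : ℕ, ∀ β (x : Fin n → ℝ) (t : ℝ), InBox A x →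
      Pinned A s u w x → Near s t x →
      ∃ y, CReach α β A Epst Eneg N x y ∧ InBox A y ∧ Pinned A s u w y ∧
        Near s t y ∧ ∀ v ∈ V, min α (1 - α) ^ N * (A - t) ≤ s v * y v - t by
    obtain ⟨N, hN⟩ := H Finset.univ
    refine ⟨N, fun β x t hx hp hNr => ?_⟩
    obtain ⟨y, h1, h2, h3, -, h5⟩ := hN β x t hx hp hNr
    exact ⟨y, h1, h2, h3, fun i => by linarith [h5 i (Finset.mem_univ i)]⟩
  set m := min α (1 - α)
  intro V
  induction V using Finset.induction_on with
  | empty => exact ⟨0, fun β x t hx hp hN => ⟨x, .refl _ _, hx, hp, hN, by simp⟩⟩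
  | insert v V _ ih =>
    obtain ⟨N, hN⟩ := ih
    obtain ⟨M, hM⟩ := h.spread_single (A := A) hα0 hα1 v
    refine ⟨N + M, fun β x t hx hp hNr => ?_⟩
    obtain ⟨y, h1, h2, h3, h4, h5⟩ := hN β x t hx hp hNr
    obtain ⟨z, k1, k2, k3, k4, k5⟩ := hM β y t h2 h3 h4
    have hAt : 0 ≤ A - t := by have := hNr u; rw [hp.1] at this; linarith
    refine ⟨z, h1.trans k1, k2, k3, fun i => ?_, fun i hi => ?_⟩
    · have : 0 ≤ m ^ M * (s i * y i - t) := mul_nonneg (by positivity) (by linarith [h4 i])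
      linarith [k4 i]
    · rcases Finset.mem_insert.mp hi with rfl | hi
      · refine le_trans ?_ k5
        exact mul_le_mul_of_nonneg_right
          (pow_le_pow_of_le_one hm0.le hm1 (Nat.le_add_left M N)) hAt
      · refine le_trans ?_ (k4 i)
        rw [pow_add, mul_comm (m ^ N), mul_assoc]
        have := h5 i hi
        gcongr

lemma SignedBalance.cluster_of_pinned (h : SignedBalance Epst Eneg s u w) (hA : 0 < A)
    (hα0 : 0 < α) (hα1 : α < 1) :
    ∃ N : ℕ, ∀ β (x : Fin n → ℝ), InBox A x → Pinned A s u w x →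
      ∃ y, CReach α β A Epst Eneg N x y ∧ Near s (A / 2) y := by
  obtain ⟨N, hN⟩ := h.spread (A := A) hα0 hα1
  have hm0 : 0 < min α (1 - α) := lt_min hα0 (by linarith)
  have hm1 : min α (1 - α) ≤ 1 := (min_le_left _ _).trans hα1.le
  set c := min α (1 - α) ^ N with hc
  have hc0 : 0 < c := by positivity
  have hc1 : c ≤ 1 := pow_le_one₀ hm0.le hm1
  obtain ⟨k, hk⟩ := exists_pow_lt_of_lt_one (show (0 : ℝ) < 1 / 4 by norm_num)
    (show 1 - c < 1 by linarith)
  refine ⟨k * N, fun β x hx hp => ?_⟩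
  have key : ∀ j : ℕ, ∃ y, CReach α β A Epst Eneg (j * N) x y ∧ InBox A y ∧ Pinned A s u w y ∧
      Near s (A - (1 - c) ^ j * (2 * A)) y := by
    intro j
    induction j with
    | zero =>
      refine ⟨x, .refl _ _, hx, hp, fun i => ?_⟩
      have h1 := hx i
      rcases h.sign i with hi | hi <;> rw [hi] <;> simp only [pow_zero] <;>
        linarith [h1.1, h1.2]
    | succ j ih =>
      obtain ⟨y, h1, h2, h3, h4⟩ := ih
      obtain ⟨z, k1, k2, k3, k4⟩ := hN β y _ h2 h3 h4
      refine ⟨z, (h1.trans k1).mono (by rw [Nat.succ_mul]), k2, k3, fun i => le_trans ?_ (k4 i)⟩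
      rw [pow_succ]
      exact le_of_eq (by ring)
  obtain ⟨y, h1, -, -, h4⟩ := key k
  exact ⟨y, h1, fun i => le_trans (by nlinarith) (h4 i)⟩

/-- Inside a cluster state, the distance to the boundary can be shrunk by a fixed factor. -/
lemma SignedBalance.contract (h : SignedBalance Epst Eneg s u w) (hA : 0 < A)
    (hα0 : 0 < α) (hα1 : α < 1) :
    ∃ N : ℕ, ∃ c : ℝ, 0 < c ∧ c ≤ 1 ∧ ∀ β (x : Fin n → ℝ) (t : ℝ), 1 ≤ β → A / 2 ≤ t →
      InBox A x → Near s t x →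
      ∃ y, CReach α β A Epst Eneg N x y ∧ Near s (t + c * (A - t)) y := by
  obtain ⟨N, hN⟩ := h.spread (A := A) hα0 hα1
  have hm0 : 0 < min α (1 - α) := lt_min hα0 (by linarith)
  have hm1 : min α (1 - α) ≤ 1 := (min_le_left _ _).trans hα1.le
  refine ⟨1 + 1 + N, min α (1 - α) ^ N, by positivity, pow_le_one₀ hm0.le hm1,
    fun β x t hβ ht hx hNr => ?_⟩
  have hpin : ∀ (i j : Fin n) (x : Fin n → ℝ), s(i, j) ∈ Eneg → Near s t x →
      s i * projA A (x i + β * (x i - x j)) = A := by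
    intro i j x hij hx
    rw [mul_projA hA.le (h.sign i)]
    refine projA_of_ge hA.le ?_
    have h1 := hx i
    have h2 := hx j
    rw [h.neg _ _ hij] at h2
    nlinarith
  have htA : t ≤ A := by
    refine (hNr u).trans ?_
    rcases h.sign u with hu | hu <;> rw [hu] <;> linarith [(hx u).1, (hx u).2]
  have hstep : ∀ (i j : Fin n) (x : Fin n → ℝ), s(i, j) ∈ Eneg → Near s t x →
      Near s t (Function.update x i (projA A (x i + β * (x i - x j)))) := by
    intro i j x hij hx k
    by_cases hk : k = i
    · subst hk
      rw [Function.update_self, hpin k j x hij hx]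
      exact htA
    · rw [Function.update_of_ne hk]; exact hx k
  set x' := Function.update x u (projA A (x u + β * (x u - x w))) with hx'
  have hN' : Near s t x' := hstep u w x h.edge hNr
  set x'' := Function.update x' w (projA A (x' w + β * (x' w - x' u))) with hx''
  have hN'' : Near s t x'' := hstep w u x' h.edge_symm hN'
  have hp : Pinned A s u w x'' := by
    refine ⟨?_, ?_⟩
    · rw [hx'', Function.update_of_ne h.ne_uw, hx', Function.update_self]
      exact hpin u w x h.edge hNr
    · rw [hx'', Function.update_self]
      exact hpin w u x' h.edge_symm hN'
  have hb : InBox A x'' := (hx.update _ (projA_mem hA.le _)).update _ (projA_mem hA.le _)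
  obtain ⟨y, k1, -, -, k4⟩ := hN β x'' t hb hp hN''
  exact ⟨y, ((cReach_neg h.disj h.edge x).trans (cReach_neg h.disj h.edge_symm x')).trans k1, k4⟩

/-- From a state with spread `d`, in boundedly many updates the process either multiplies the
spread by a fixed multiple of `β` or enters a cluster state. -/
lemma SignedBalance.grow (h : SignedBalance Epst Eneg s u w) (hA : 0 < A)
    (hα0 : 0 < α) (hα1 : α < 1) :
    ∃ N : ℕ, ∃ κ : ℝ, 0 < κ ∧ ∀ β (x : Fin n → ℝ), 0 ≤ β → InBox A x →
      ∃ y, CReach α β A Epst Eneg N x y ∧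
        (β * (κ * diam x) ≤ diam y ∨ Near s (A / 2) y ∨ Near (-s) (A / 2) y) := by
  have hsymm : ∀ {a b : Fin n}, Relation.ReflTransGen (fun a b => s(a, b) ∈ Epst) a b →
      Relation.ReflTransGen (fun a b => s(a, b) ∈ Epst) b a := fun hab => by
    have : Std.Symm (fun a b : Fin n => s(a, b) ∈ Epst) :=
      ⟨fun a b h => by rwa [Sym2.eq_swap]⟩
    exact Std.Symm.symm _ _ hab
  have : NeZero n := ⟨fun h0 => by subst h0; exact u.elim0⟩
  have hK : 1 ≤ 2 / α := by rw [le_div_iff₀ hα0]; linarith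
  -- the discrepancy at a single node is moved to the edge `{u, w}`
  have hnode : ∀ v, ∃ N : ℕ, ∀ β (x : Fin n → ℝ) (ε : ℝ), InBox A x → 0 ≤ ε →
      2 * ((2 / α) ^ N * ε) ≤ |x v - x w| →
      ∃ y, CReach α β A Epst Eneg N x y ∧ InBox A y ∧ ε ≤ |y u - y w| := by
    intro v
    rcases h.reach v with hv | hv
    · obtain ⟨N, hN⟩ := h.transport (A := A) hα0 hα1.le (hsymm hv) h.sign_ne.symm
      refine ⟨N, fun β x ε hx hε hxv => ?_⟩
      have : 0 ≤ (2 / α) ^ N * ε := by positivity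
      obtain ⟨y, h1, h2, h3, h4⟩ := hN β x ε hx (by linarith)
      exact ⟨y, h1, h2, by rwa [h3]⟩
    · obtain ⟨N, hN⟩ := h.transport (A := A) hα0 hα1.le (hsymm hv) h.sign_ne
      refine ⟨N, fun β x ε hx hε hxv => ?_⟩
      have hge : ε ≤ (2 / α) ^ N * ε := le_mul_of_one_le_left hε (one_le_pow₀ hK)
      by_cases hu : (2 / α) ^ N * ε ≤ |x v - x u|
      · obtain ⟨y, h1, h2, h3, h4⟩ := hN β x ε hx hu
        exact ⟨y, h1, h2, by rwa [h3, abs_sub_comm]⟩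
      · refine ⟨x, .refl _ _, hx, ?_⟩
        have := abs_sub_le (x v) (x u) (x w)
        linarith
  choose Nv hNv using hnode
  obtain ⟨N1, hN1⟩ := h.cluster_of_pinned hA hα0 hα1
  obtain ⟨N2, hN2⟩ := h.neg_sign.cluster_of_pinned hA hα0 hα1
  set M := ∑ v, Nv v with hM
  have hMv : ∀ v, Nv v ≤ M := fun v =>
    Finset.single_le_sum (f := Nv) (fun _ _ => Nat.zero_le _) (Finset.mem_univ v)
  have hpow : 0 < (2 / α) ^ M := by positivity
  refine ⟨M + 2 + (N1 + N2), (1 / 4) / (2 / α) ^ M, by positivity, fun β x hβ hx => ?_⟩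
  set ε := (1 / 4) / (2 / α) ^ M * diam x with hε
  have hd0 : 0 ≤ diam x := by simpa using sub_le_diam x u u
  have hε0 : 0 ≤ ε := by positivity
  obtain ⟨v, hv⟩ : ∃ v, diam x / 2 ≤ |x v - x w| := by
    obtain ⟨p, q, -, -, hpq⟩ := exists_extremal_pair x
    by_contra! hcon
    have h1 := hcon p
    have h2 := hcon q
    have h3 := le_abs_self (x p - x w)
    have h4 := neg_abs_le (x q - x w)
    linarith
  obtain ⟨y, h1, h2, h3⟩ := hNv v β x ε hx hε0 (by
    refine le_trans ?_ hv
    have hle : (2 / α) ^ Nv v ≤ (2 / α) ^ M := pow_le_pow_right₀ hK (hMv v)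
    calc 2 * ((2 / α) ^ Nv v * ε) ≤ 2 * ((2 / α) ^ M * ε) := by gcongr
      _ = diam x / 2 := by rw [hε]; field_simp; norm_num)
  have hsw : s w = -s u := h.neg _ _ h.edge
  have hfin : ∀ z, CReach α β A Epst Eneg 2 y z → InBox A z →
      (β * ε ≤ diam z ∨ (z u = A ∧ z w = -A) ∨ (z w = A ∧ z u = -A)) →
      ∃ y, CReach α β A Epst Eneg (M + 2 + (N1 + N2)) x y ∧
        (β * ε ≤ diam y ∨ Near s (A / 2) y ∨ Near (-s) (A / 2) y) := by
    intro z hz hbz hcase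
    have hxz := (h1.mono (hMv v)).trans hz
    have hpin : Pinned A s u w z ∨ Pinned A (-s) u w z ∨ β * ε ≤ diam z := by
      rcases hcase with hc | ⟨hc1, hc2⟩ | ⟨hc1, hc2⟩
      · exact Or.inr (Or.inr hc)
      all_goals rcases h.sign u with hu | hu <;> simp [Pinned, hsw, hu, hc1, hc2]
    rcases hpin with hp | hp | hp
    · obtain ⟨y', k1, k2⟩ := hN1 β z hbz hp
      exact ⟨y', (hxz.trans k1).mono (by omega), Or.inr (Or.inl k2)⟩
    · obtain ⟨y', k1, k2⟩ := hN2 β z hbz hp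
      exact ⟨y', (hxz.trans k1).mono (by omega), Or.inr (Or.inr k2)⟩
    · exact ⟨z, hxz.mono (by omega), Or.inl hp⟩
  rcases le_total (y w) (y u) with hle | hle
  · obtain ⟨z, k1, k2, k3⟩ := grow_or_pin (α := α) h.disj hA.le hβ h.ne_uw h.edge h2 hle
    refine hfin z k1 k2 (k3.imp (fun k => ?_) Or.inl)
    rw [abs_of_nonneg (by linarith)] at h3
    exact (mul_le_mul_of_nonneg_left h3 hβ).trans (k.trans (sub_le_diam z _ _))
  · obtain ⟨z, k1, k2, k3⟩ :=
      grow_or_pin (α := α) h.disj hA.le hβ h.ne_uw.symm h.edge_symm h2 hle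
    refine hfin z k1 k2 (k3.imp (fun k => ?_) Or.inr)
    rw [abs_of_nonpos (by linarith), neg_sub] at h3
    exact (mul_le_mul_of_nonneg_left h3 hβ).trans (k.trans (sub_le_diam z _ _))

end Balance
section Potential

variable {n : ℕ} {Epst Eneg : Finset (Sym2 (Fin n))} {α β A r : ℝ} {s : Fin n → ℝ} {u w : Fin n}

/-- The largest `t` such that all beliefs are signed by `s`, or all by `-s`, with margin `t`. -/
def clusterLevel (s x : Fin n → ℝ) : ℝ := max (⨅ i, s i * x i) (⨅ i, (-s) i * x i)

lemma le_clusterLevel_iff [NeZero n] {t : ℝ} {x : Fin n → ℝ} :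
    t ≤ clusterLevel s x ↔ Near s t x ∨ Near (-s) t x := by
  rw [clusterLevel, le_max_iff, le_ciInf_iff (Set.finite_range _).bddBelow,
    le_ciInf_iff (Set.finite_range _).bddBelow]
  rfl

lemma InBox.sign_mul_le {x : Fin n → ℝ} (hx : InBox A x) {σ : ℝ} (hσ : σ = 1 ∨ σ = -1)
    (i : Fin n) : σ * x i ≤ A := by
  rcases hσ with h | h <;> rw [h] <;> linarith [(hx i).1, (hx i).2]

lemma SignedBalance.clusterLevel_le (h : SignedBalance Epst Eneg s u w) {x : Fin n → ℝ}
    (hx : InBox A x) : clusterLevel s x ≤ A := by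
  have : NeZero n := ⟨fun h0 => by subst h0; exact u.elim0⟩
  rcases le_clusterLevel_iff.mp (le_refl (clusterLevel s x)) with hN | hN
  · exact (hN u).trans (hx.sign_mul_le (h.sign u) u)
  · exact (hN u).trans (hx.sign_mul_le (h.neg_sign.sign u) u)

lemma SignedBalance.clusterLevel_cstep (h : SignedBalance Epst Eneg s u w) (hA : 0 ≤ A)
    (hα0 : 0 ≤ α) (hα1 : α ≤ 1) (hβ : 0 ≤ β) {x : Fin n → ℝ} (hx : InBox A x)
    (h0 : 0 ≤ clusterLevel s x) (l : Sel2 n) :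
    clusterLevel s x ≤ clusterLevel s (cstep α β A Epst Eneg l x) := by
  have : NeZero n := ⟨fun h0 => by subst h0; exact u.elim0⟩
  rcases le_clusterLevel_iff.mp (le_refl (clusterLevel s x)) with hN | hN
  · exact le_clusterLevel_iff.mpr (Or.inl (hN.cstep h hA hα0 hα1 hβ hx h0 l))
  · exact le_clusterLevel_iff.mpr (Or.inr (hN.cstep h.neg_sign hA hα0 hα1 hβ hx h0 l))

/-- The Lyapunov function: a negative power of the spread outside the cluster states, and the
normalised distance to the boundary inside them. -/
def potential (A r : ℝ) (s x : Fin n → ℝ) : ℝ :=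
  if A / 2 ≤ clusterLevel s x then (A - clusterLevel s x) / A else (diam x / (2 * A)) ^ (-r)

lemma potential_of_cluster {x : Fin n → ℝ} (hc : A / 2 ≤ clusterLevel s x) :
    potential A r s x = (A - clusterLevel s x) / A := if_pos hc

lemma potential_of_not_cluster {x : Fin n → ℝ} (hc : ¬A / 2 ≤ clusterLevel s x) :
    potential A r s x = (diam x / (2 * A)) ^ (-r) := if_neg hc

lemma potential_le_half (hA : 0 < A) {x : Fin n → ℝ} (hc : A / 2 ≤ clusterLevel s x) :
    potential A r s x ≤ 1 / 2 := by
  rw [potential_of_cluster hc, div_le_iff₀ hA]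
  linarith

lemma one_le_potential [NeZero n] (hA : 0 < A) (hr : 0 ≤ r) {x : Fin n → ℝ} (hx : InBox A x)
    (hd : 0 < diam x) (hc : ¬A / 2 ≤ clusterLevel s x) : 1 ≤ potential A r s x := by
  rw [potential_of_not_cluster hc]
  refine Real.one_le_rpow_of_pos_of_le_one_of_nonpos (by positivity) ?_ (by linarith)
  rw [div_le_one (by linarith)]
  exact hx.diam_le

lemma SignedBalance.potential_nonneg (h : SignedBalance Epst Eneg s u w) (hA : 0 < A)
    {x : Fin n → ℝ} (hx : InBox A x) (hd : 0 < diam x) : 0 ≤ potential A r s x := by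
  by_cases hc : A / 2 ≤ clusterLevel s x
  · rw [potential_of_cluster hc]
    exact div_nonneg (by linarith [h.clusterLevel_le hx]) hA.le
  · rw [potential_of_not_cluster hc]
    positivity

lemma SignedBalance.potential_cstep_le (h : SignedBalance Epst Eneg s u w) (hA : 0 < A)
    (hα0 : 0 < α) (hα1 : α < 1) (hαhalf : α ≠ 1 / 2) (hβ : 0 ≤ β) (hr : 0 ≤ r)
    {x : Fin n → ℝ} (hx : InBox A x) (hd : 0 < diam x) (l : Sel2 n) :
    potential A r s (cstep α β A Epst Eneg l x) ≤
      min (1 - α) |1 - 2 * α| ^ (-r) * potential A r s x := by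
  have : NeZero n := ⟨fun h0 => by subst h0; exact u.elim0⟩
  have hc0 : 0 < min (1 - α) |1 - 2 * α| :=
    lt_min (by linarith) (abs_pos.mpr fun h0 => hαhalf (by linarith))
  have hC : 1 ≤ min (1 - α) |1 - 2 * α| ^ (-r) :=
    Real.one_le_rpow_of_pos_of_le_one_of_nonpos hc0 ((min_le_left _ _).trans (by linarith))
      (by linarith)
  have hdiam := diam_cstep_ge h.disj h.ne hα0.le hα1.le hβ hx l
  have hF := h.potential_nonneg (r := r) hA hx hd
  by_cases hc : A / 2 ≤ clusterLevel s x
  · have hle := h.clusterLevel_cstep hA.le hα0.le hα1.le hβ hx (by linarith) l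
    refine le_trans ?_ (le_mul_of_one_le_left hF hC)
    rw [potential_of_cluster hc, potential_of_cluster (hc.trans hle)]
    gcongr
  · have h1 := one_le_potential hA hr hx hd hc
    by_cases hc' : A / 2 ≤ clusterLevel s (cstep α β A Epst Eneg l x)
    · have := potential_le_half (r := r) hA hc'
      nlinarith
    · rw [potential_of_not_cluster hc, potential_of_not_cluster hc',
        ← Real.mul_rpow hc0.le (by positivity)]
      refine Real.rpow_le_rpow_of_nonpos (by positivity) ?_ (by linarith)
      rw [← mul_div_assoc]
      gcongr

/-- For large `β` the mean potential decays geometrically. -/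
lemma SignedBalance.exists_decay (h : SignedBalance Epst Eneg s u w) (hA : 0 < A)
    (hα0 : 0 < α) (hα1 : α < 1) (hαhalf : α ≠ 1 / 2) {q : Sel2 n → ℝ} (hq : ∀ l, 0 ≤ q l)
    (hq1 : ∑ l, q l = 1) {p : ℝ} (hp : 0 < p) (hp1 : p ≤ 1)
    (hpq : ∀ l, IsUpd Epst Eneg l → p ≤ q l) :
    ∃ β0 : ℝ, 0 < β0 ∧ ∀ β, β0 < β → 0 ≤ β ∧ ∃ (r : ℝ) (T : ℕ) (ρ : ℝ), 0 ≤ r ∧ 0 ≤ ρ ∧ ρ < 1 ∧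
      ∀ (k : ℕ) (x : Fin n → ℝ), InBox A x → 0 < diam x →
        expect q (cstep α β A Epst Eneg) (potential A r s) (k * T) x ≤
          ρ ^ k * potential A r s x := by
  have : NeZero n := ⟨fun h0 => by subst h0; exact u.elim0⟩
  obtain ⟨N, κ, hκ, hgrow⟩ := h.grow hA hα0 hα1
  obtain ⟨N1, c1, hc1, hc1', hcon1⟩ := h.contract hA hα0 hα1
  obtain ⟨N2, c2, hc2, hc2', hcon2⟩ := h.neg_sign.contract hA hα0 hα1
  set T := N + (N1 + N2) with hT
  have hcmin : 0 < min c1 c2 := lt_min hc1 hc2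
  set η := max (1 / 2) (1 - min c1 c2) with hη
  have hη0 : 0 ≤ η := le_max_of_le_left (by norm_num)
  have hη1 : η < 1 := max_lt (by norm_num) (by linarith)
  have hηh : 1 / 2 ≤ η := le_max_left _ _
  have hηc : 1 - min c1 c2 ≤ η := le_max_right _ _
  have hc0 : 0 < min (1 - α) |1 - 2 * α| :=
    lt_min (by linarith) (abs_pos.mpr fun h0 => hαhalf (by linarith))
  obtain ⟨r, hr, hrρ⟩ : ∃ r : ℝ, 0 < r ∧
      (min (1 - α) |1 - 2 * α| ^ (-r)) ^ T * (1 - p ^ T * (1 - η)) < 1 := by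
    have hcont : Continuous fun r : ℝ =>
        (min (1 - α) |1 - 2 * α| ^ (-r)) ^ T * (1 - p ^ T * (1 - η)) := by
      have : Continuous fun r : ℝ => min (1 - α) |1 - 2 * α| ^ (-r) :=
        Real.continuous_const_rpow hc0.ne' |>.comp continuous_neg
      fun_prop
    have hlt : (fun r : ℝ =>
        (min (1 - α) |1 - 2 * α| ^ (-r)) ^ T * (1 - p ^ T * (1 - η))) 0 < 1 := by
      have : 0 < p ^ T * (1 - η) := mul_pos (by positivity) (by linarith)
      simp only [neg_zero, Real.rpow_zero, one_pow, one_mul]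
      linarith
    have hev := (hcont.tendsto 0).eventually_lt_const hlt
    obtain ⟨r, hr, hr0⟩ := ((hev.filter_mono (nhdsWithin_le_nhds (s := Set.Ioi 0))).and
      self_mem_nhdsWithin).exists
    exact ⟨r, hr0, hr⟩
  have h2r : 0 < (2 : ℝ) ^ (1 / r) := by positivity
  refine ⟨max 1 (2 ^ (1 / r) / κ), by positivity, fun β hβ => ?_⟩
  have hβ1 : 1 < β := (le_max_left _ _).trans_lt hβ
  have hβκ : 2 ^ (1 / r) ≤ β * κ := by
    have := (le_max_right _ _).trans_lt hβ
    rw [div_lt_iff₀ hκ] at this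
    exact this.le
  have hshrink : (β * κ) ^ (-r) ≤ 1 / 2 := by
    calc (β * κ) ^ (-r) ≤ ((2 : ℝ) ^ (1 / r)) ^ (-r) :=
          Real.rpow_le_rpow_of_nonpos h2r hβκ (by linarith)
      _ = 1 / 2 := by
        rw [← Real.rpow_mul (by norm_num), show 1 / r * -r = -1 by field_simp, Real.rpow_neg_one]
        norm_num
  have hC : 1 ≤ min (1 - α) |1 - 2 * α| ^ (-r) :=
    Real.one_le_rpow_of_pos_of_le_one_of_nonpos hc0 ((min_le_left _ _).trans (by linarith))
      (by linarith)
  have hβ0 : 0 ≤ β := by linarith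
  have hρ0 : 0 ≤ (min (1 - α) |1 - 2 * α| ^ (-r)) ^ T * (1 - p ^ T * (1 - η)) := by
    have h1 : p ^ T ≤ 1 := pow_le_one₀ hp.le hp1
    have h2 : 0 ≤ p ^ T := by positivity
    exact mul_nonneg (by positivity) (by nlinarith)
  refine ⟨hβ0, r, T, _, hr.le, hρ0, hrρ, fun k x hx hd => ?_⟩
  refine expect_le_geometric (I := fun x => InBox A x ∧ 0 < diam x) (supp := IsUpd Epst Eneg)
    hq hq1 (fun l x hx => ⟨hx.1.cstep hA.le h.disj h.ne hα0.le hα1.le l,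
      (mul_pos hc0 hx.2).trans_le (diam_cstep_ge h.disj h.ne hα0.le hα1.le hβ0 hx.1 l)⟩)
    (fun x hx => h.potential_nonneg hA hx.1 hx.2) hC
    (fun l x hx => h.potential_cstep_le hA hα0 hα1 hαhalf hβ0 hr.le hx.1 hx.2 l)
    hp.le hp1 hpq hη0 hη1.le (fun x hx => ?_) k ⟨hx, hd⟩
  obtain ⟨hx, hd⟩ := hx
  by_cases hc : A / 2 ≤ clusterLevel s x
  · have hlevel : ∀ {c : ℝ} {y}, min c1 c2 ≤ c →
        clusterLevel s x + c * (A - clusterLevel s x) ≤ clusterLevel s y →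
        potential A r s y ≤ η * potential A r s x := by
      intro c y hcc hy
      have hle := h.clusterLevel_le hx
      have h3 := mul_le_mul_of_nonneg_right (show 1 - c ≤ η by linarith)
        (show 0 ≤ A - clusterLevel s x by linarith)
      rw [potential_of_cluster hc, potential_of_cluster (hc.trans (by nlinarith)),
        ← mul_div_assoc]
      refine div_le_div_of_nonneg_right ?_ hA.le
      linarith
    rcases le_clusterLevel_iff.mp (le_refl (clusterLevel s x)) with hN | hN
    · obtain ⟨y, h1, h2⟩ := hcon1 β x _ hβ1.le hc hx hN
      exact ⟨y, h1.mono (by omega), hlevel (min_le_left _ _)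
        (le_clusterLevel_iff.mpr (Or.inl h2))⟩
    · obtain ⟨y, h1, h2⟩ := hcon2 β x _ hβ1.le hc hx hN
      exact ⟨y, h1.mono (by omega), hlevel (min_le_right _ _)
        (le_clusterLevel_iff.mpr (Or.inr h2))⟩
  · obtain ⟨y, h1, h2⟩ := hgrow β x hβ0 hx
    refine ⟨y, h1.mono (by omega), ?_⟩
    have hx1 := one_le_potential hA hr.le hx hd hc
    by_cases hcy : A / 2 ≤ clusterLevel s y
    · have := potential_le_half (r := r) hA hcy
      nlinarith
    · rcases h2 with h2 | h2
      · rw [potential_of_not_cluster hc, potential_of_not_cluster hcy]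
        calc (diam y / (2 * A)) ^ (-r) ≤ (β * κ * (diam x / (2 * A))) ^ (-r) := by
              refine Real.rpow_le_rpow_of_nonpos (by positivity) ?_ (by linarith)
              rw [← mul_div_assoc, mul_assoc]
              gcongr
          _ = (β * κ) ^ (-r) * (diam x / (2 * A)) ^ (-r) :=
              Real.mul_rpow (by positivity) (by positivity)
          _ ≤ η * (diam x / (2 * A)) ^ (-r) := by
              gcongr
              exact hshrink.trans hηh
      · exact absurd (le_clusterLevel_iff.mpr h2) hcy

end Potential

section Probability

variable {n : ℕ} {Epst Eneg : Finset (Sym2 (Fin n))} {α β A : ℝ}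
  {P : Matrix (Fin n) (Fin n) ℝ} {E : Finset (Sym2 (Fin n))} {a b c : ℝ}

lemma cproc_succ' (x0 : Fin n → ℝ) (ω : ℕ → Sel2 n) (m : ℕ) :
    cproc α β A Epst Eneg x0 ω (m + 1) =
      cproc α β A Epst Eneg (cstep α β A Epst Eneg (ω 0) x0) (fun k => ω (k + 1)) m := by
  induction m with
  | zero => rfl
  | succ m ih => rw [cproc, ih]; rfl

lemma cproc_eq_runWord (x0 : Fin n → ℝ) (ω : ℕ → Sel2 n) (m : ℕ) :
    cproc α β A Epst Eneg x0 ω m =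
      runWord (cstep α β A Epst Eneg) m (fun i : Fin m => ω i) x0 := by
  induction m generalizing x0 ω with
  | zero => rfl
  | succ m ih => rw [cproc_succ', ih]; rfl

lemma seldist2_ne_top (l : Sel2 n) : seldist2 P E a b c l ≠ ⊤ := by
  obtain ⟨_ | ⟨i, j⟩, t⟩ := l
  · exact ENNReal.mul_ne_top ENNReal.ofReal_ne_top ENNReal.ofReal_ne_top
  · simp only [seldist2]
    split_ifs
    · exact ENNReal.mul_ne_top ENNReal.ofReal_ne_top ENNReal.ofReal_ne_top
    · simp

lemma IsIIDSel2.sum_toReal {ℙ : Measure (ℕ → Sel2 n)} [IsProbabilityMeasure ℙ]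
    (hiid : IsIIDSel2 ℙ P E a b c) : ∑ l, (seldist2 P E a b c l).toReal = 1 := by
  have hl : ∀ l, seldist2 P E a b c l = ℙ ((fun ω : ℕ → Sel2 n => ω 0) ⁻¹' {l}) := fun l => by
    have := hiid {0} (fun _ => l)
    simp only [Finset.mem_singleton, forall_eq, Finset.prod_singleton] at this
    exact this.symm
  rw [← ENNReal.toReal_sum fun l _ => seldist2_ne_top l]
  simp_rw [hl]
  rw [sum_measure_preimage_singleton]
  · simp
  · intro l _
    exact measurable_pi_apply 0 (MeasurableSpace.measurableSet_top)

/-- Markov's inequality for the constrained process. -/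
lemma IsIIDSel2.measure_le {ℙ : Measure (ℕ → Sel2 n)}
    (hiid : IsIIDSel2 ℙ P E a b c) {F : (Fin n → ℝ) → ℝ} {I : (Fin n → ℝ) → Prop}
    (hI : ∀ l x, I x → I (cstep α β A Epst Eneg l x)) (hF : ∀ x, I x → 0 ≤ F x)
    {x0 : Fin n → ℝ} (hx0 : I x0) {ε : ℝ} (hε : 0 < ε) (m : ℕ) :
    ℙ {ω | ε ≤ F (cproc α β A Epst Eneg x0 ω m)} ≤
      ENNReal.ofReal (expect (fun l => (seldist2 P E a b c l).toReal)
        (cstep α β A Epst Eneg) F m x0 / ε) := by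
  classical
  set run := fun v : Fin m → Sel2 n => runWord (cstep α β A Epst Eneg) m v x0 with hrun
  set good := Finset.univ.filter fun v => ε ≤ F (run v) with hgood
  have hcyl : ∀ v : Fin m → Sel2 n, ℙ {ω | (fun i : Fin m => ω i) = v} =
      ENNReal.ofReal (∏ i, (seldist2 P E a b c (v i)).toReal) := by
    intro v
    rw [ENNReal.ofReal_prod_of_nonneg fun _ _ => ENNReal.toReal_nonneg]
    simp_rw [ENNReal.ofReal_toReal (seldist2_ne_top _)]
    have := hiid (Finset.range m) (fun k => if hk : k < m then v ⟨k, hk⟩ else (none, 0))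
    rw [Finset.prod_range] at this
    simp only [Fin.is_lt, dite_true, Fin.eta] at this
    rw [← this]
    congr 1
    ext ω
    simp only [Set.mem_ofPred_eq, Finset.mem_range, funext_iff]
    constructor
    · intro h k hk
      simpa [hk] using h ⟨k, hk⟩
    · intro h i
      simpa using h i i.2
  calc ℙ {ω | ε ≤ F (cproc α β A Epst Eneg x0 ω m)}
      ≤ ℙ (⋃ v ∈ good, {ω | (fun i : Fin m => ω i) = v}) := by
        refine measure_mono fun ω hω => ?_
        rw [Set.mem_ofPred_eq, cproc_eq_runWord] at hω
        simpa [hgood] using hω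
    _ ≤ ∑ v ∈ good, ℙ {ω | (fun i : Fin m => ω i) = v} := measure_biUnion_finset_le _ _
    _ = ENNReal.ofReal (∑ v ∈ good, ∏ i, (seldist2 P E a b c (v i)).toReal) := by
        rw [ENNReal.ofReal_sum_of_nonneg fun _ _ =>
          Finset.prod_nonneg fun _ _ => ENNReal.toReal_nonneg]
        exact Finset.sum_congr rfl fun v _ => hcyl v
    _ ≤ _ := by
        refine ENNReal.ofReal_le_ofReal ?_
        rw [le_div_iff₀ hε, Finset.sum_mul, expect_eq_sum]
        calc _ ≤ ∑ v ∈ good, (∏ i, (seldist2 P E a b c (v i)).toReal) * F (run v) :=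
              Finset.sum_le_sum fun v hv => mul_le_mul_of_nonneg_left
                (Finset.mem_filter.mp hv).2 (Finset.prod_nonneg fun _ _ => ENNReal.toReal_nonneg)
          _ ≤ _ := Finset.sum_le_univ_sum_of_nonneg fun v =>
              mul_nonneg (Finset.prod_nonneg fun _ _ => ENNReal.toReal_nonneg)
                (hF _ (runWord_preserves hI m v hx0))

end Probability

section Limit

variable {n : ℕ} {Epst Eneg : Finset (Sym2 (Fin n))} {α β A r ρ : ℝ} {s : Fin n → ℝ} {u w : Fin n}
  {P : Matrix (Fin n) (Fin n) ℝ} {E : Finset (Sym2 (Fin n))} {a b c : ℝ} {x0 : Fin n → ℝ}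

lemma seldist2_upd_pos {i j : Fin n} (hij : s(i, j) ∈ E) (hne : i ≠ j) (hp : 0 < P i j + P j i)
    (ha : 0 < a) (hb : 0 < b) : 0 < (seldist2 P E a b c (upd i j)).toReal := by
  have hn : (0 : ℝ) < n := by exact_mod_cast i.pos
  refine ENNReal.toReal_pos ?_ (seldist2_ne_top _)
  rcases lt_or_gt_of_ne hne with h | h
  · have hw : 0 < edgeWeight P s(i, j) := div_pos hp hn
    simp [upd, h, seldist2, hij, wabc, ha, hw]
  · have hji : s(j, i) ∈ E := by rwa [Sym2.eq_swap]
    have hw : 0 < edgeWeight P s(j, i) := div_pos (by linarith) hn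
    simp [upd, h.not_gt, h, seldist2, hji, wabc, hb, hw]

lemma exists_pos_le_of_forall_pos {ι : Type*} [Fintype ι] {q : ι → ℝ} {supp : ι → Prop}
    (h : ∀ l, supp l → 0 < q l) : ∃ p : ℝ, 0 < p ∧ p ≤ 1 ∧ ∀ l, supp l → p ≤ q l := by
  classical
  have hfin : (insert 1 ((Finset.univ.filter supp).image q)).Nonempty :=
    Finset.insert_nonempty _ _
  refine ⟨(insert 1 ((Finset.univ.filter supp).image q)).min' hfin, ?_, ?_, fun l hl => ?_⟩
  · rw [Finset.lt_min'_iff]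
    simp only [Finset.mem_insert, Finset.mem_image, Finset.mem_filter, Finset.mem_univ, true_and]
    rintro y (rfl | ⟨l, hl, rfl⟩)
    · exact one_pos
    · exact h l hl
  · exact Finset.min'_le _ _ (Finset.mem_insert_self _ _)
  · exact Finset.min'_le _ _ (Finset.mem_insert_of_mem
      (Finset.mem_image_of_mem q (by simpa using hl)))

lemma SignedBalance.step_invariant (h : SignedBalance Epst Eneg s u w) (hA : 0 < A)
    (hα0 : 0 < α) (hα1 : α < 1) (hαhalf : α ≠ 1 / 2) (hβ : 0 ≤ β) (l : Sel2 n) {x : Fin n → ℝ}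
    (hx : InBox A x ∧ 0 < diam x) :
    InBox A (cstep α β A Epst Eneg l x) ∧ 0 < diam (cstep α β A Epst Eneg l x) := by
  have : NeZero n := ⟨fun h0 => by subst h0; exact u.elim0⟩
  have hc0 : 0 < min (1 - α) |1 - 2 * α| :=
    lt_min (by linarith) (abs_pos.mpr fun h0 => hαhalf (by linarith))
  exact ⟨hx.1.cstep hA.le h.disj h.ne hα0.le hα1.le l,
    (mul_pos hc0 hx.2).trans_le (diam_cstep_ge h.disj h.ne hα0.le hα1.le hβ hx.1 l)⟩

lemma cproc_invariant {I : (Fin n → ℝ) → Prop}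
    (hI : ∀ l x, I x → I (cstep α β A Epst Eneg l x)) (hx0 : I x0) (ω : ℕ → Sel2 n) (k : ℕ) :
    I (cproc α β A Epst Eneg x0 ω k) := by
  induction k with
  | zero => exact hx0
  | succ k ih => exact hI _ _ ih

/-- Geometric decay of the mean potential forces the process to approach the cluster states. -/
lemma SignedBalance.ae_exists_near (h : SignedBalance Epst Eneg s u w) (hA : 0 < A)
    (hα0 : 0 < α) (hα1 : α < 1) (hαhalf : α ≠ 1 / 2) (hβ : 0 ≤ β) (hr : 0 ≤ r) (hρ0 : 0 ≤ ρ)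
    (hρ1 : ρ < 1) {ℙ : Measure (ℕ → Sel2 n)} (hiid : IsIIDSel2 ℙ P E a b c)
    (hx0 : InBox A x0) (hd0 : 0 < diam x0) {T : ℕ}
    (hdecay : ∀ k : ℕ, expect (fun l => (seldist2 P E a b c l).toReal) (cstep α β A Epst Eneg)
      (potential A r s) (k * T) x0 ≤ ρ ^ k * potential A r s x0) :
    ∀ᵐ ω ∂ℙ, ∀ ε : ℝ, 0 < ε → ∃ m, A - ε ≤ clusterLevel s (cproc α β A Epst Eneg x0 ω m) := by
  have : NeZero n := ⟨fun h0 => by subst h0; exact u.elim0⟩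
  have hI := fun l x => h.step_invariant (x := x) hA hα0 hα1 hαhalf hβ l
  have hsmall : ∀ j : ℕ, ∀ᵐ ω ∂ℙ, ∃ m,
      potential A r s (cproc α β A Epst Eneg x0 ω m) < 1 / ((j : ℝ) + 1) := by
    intro j
    have hj : (0 : ℝ) < 1 / ((j : ℝ) + 1) := by positivity
    rw [ae_iff]
    have hlim : Tendsto (fun k : ℕ => ENNReal.ofReal
        (ρ ^ k * potential A r s x0 / (1 / ((j : ℝ) + 1)))) atTop (nhds 0) := by
      have := ((tendsto_pow_atTop_nhds_zero_of_lt_one hρ0 hρ1).mul_const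
        (potential A r s x0)).div_const (1 / ((j : ℝ) + 1))
      simpa using ENNReal.tendsto_ofReal this
    refine le_antisymm (ge_of_tendsto' hlim fun k => ?_) zero_le
    calc _ ≤ ℙ {ω | 1 / ((j : ℝ) + 1) ≤
          potential A r s (cproc α β A Epst Eneg x0 ω (k * T))} :=
          by
          refine measure_mono fun ω hω => ?_
          rw [Set.mem_ofPred_eq] at hω ⊢
          exact not_lt.mp fun hlt => hω ⟨_, hlt⟩
      _ ≤ _ := hiid.measure_le hI (fun x hx => h.potential_nonneg hA hx.1 hx.2) ⟨hx0, hd0⟩ hj _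
      _ ≤ _ := ENNReal.ofReal_le_ofReal (div_le_div_of_nonneg_right (hdecay k) hj.le)
  filter_upwards [ae_all_iff.mpr hsmall] with ω hω ε hε
  obtain ⟨j, hj⟩ := exists_nat_one_div_lt (div_pos hε hA)
  obtain ⟨m, hm⟩ := hω j
  have hX := cproc_invariant (x0 := x0) hI ⟨hx0, hd0⟩ ω m
  have hj1 : 1 / ((j : ℝ) + 1) ≤ 1 := by
    rw [div_le_one (by positivity)]
    linarith [j.cast_nonneg (α := ℝ)]
  have hc : A / 2 ≤ clusterLevel s (cproc α β A Epst Eneg x0 ω m) := by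
    by_contra hc
    linarith [one_le_potential hA hr hX.1 hX.2 hc]
  rw [potential_of_cluster hc] at hm
  have := (div_lt_div_iff_of_pos_right hA).mp (hm.trans hj)
  exact ⟨m, by linarith⟩

lemma SignedBalance.near_of_le (h : SignedBalance Epst Eneg s u w) (hA : 0 ≤ A) (hα0 : 0 ≤ α)
    (hα1 : α ≤ 1) (hβ : 0 ≤ β) {ω : ℕ → Sel2 n} (hX : ∀ k, InBox A (cproc α β A Epst Eneg x0 ω k))
    {t : ℝ} (ht : 0 ≤ t) {m k : ℕ} (hmk : m ≤ k) (hN : Near s t (cproc α β A Epst Eneg x0 ω m)) :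
    Near s t (cproc α β A Epst Eneg x0 ω k) := by
  induction k, hmk using Nat.le_induction with
  | base => exact hN
  | succ k _ ih => exact ih.cstep h hA hα0 hα1 hβ (hX k) ht (ω k)

lemma SignedBalance.tendsto_of_near (h : SignedBalance Epst Eneg s u w) (hA : 0 < A)
    (hα0 : 0 ≤ α) (hα1 : α ≤ 1) (hβ : 0 ≤ β) {ω : ℕ → Sel2 n}
    (hX : ∀ k, InBox A (cproc α β A Epst Eneg x0 ω k))
    (hnear : ∀ ε : ℝ, 0 < ε → ∃ m, Near s (A - ε) (cproc α β A Epst Eneg x0 ω m) ∨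
      Near (-s) (A - ε) (cproc α β A Epst Eneg x0 ω m))
    {m0 : ℕ} (h0 : Near s (A / 2) (cproc α β A Epst Eneg x0 ω m0)) (i : Fin n) :
    Tendsto (fun k => cproc α β A Epst Eneg x0 ω k i) atTop (nhds (s i * A)) := by
  rw [Metric.tendsto_atTop]
  intro ε hε
  have hε' : 0 < min (ε / 2) (A / 2) := by positivity
  have ht : 0 ≤ A - min (ε / 2) (A / 2) := by linarith [min_le_right (ε / 2) (A / 2)]
  obtain ⟨m, hm | hm⟩ := hnear _ hε'
  · refine ⟨m, fun k hk => ?_⟩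
    have h1 := h.near_of_le hA.le hα0 hα1 hβ hX ht hk hm i
    have h2 := (hX k).sign_mul_le (h.sign i) i
    have h3 := min_le_left (ε / 2) (A / 2)
    rw [Real.dist_eq, abs_lt]
    rcases h.sign i with hi | hi <;> rw [hi] at h1 h2 ⊢ <;> constructor <;> linarith
  · have h1 := h.near_of_le hA.le hα0 hα1 hβ hX (by linarith) (le_max_left m0 m) h0 u
    have h2 := h.neg_sign.near_of_le hA.le hα0 hα1 hβ hX ht (le_max_right m0 m) hm u
    rw [Pi.neg_apply, neg_mul] at h2
    linarith

lemma SignedBalance.tendsto_or (h : SignedBalance Epst Eneg s u w) (hA : 0 < A)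
    (hα0 : 0 ≤ α) (hα1 : α ≤ 1) (hβ : 0 ≤ β) {ω : ℕ → Sel2 n}
    (hX : ∀ k, InBox A (cproc α β A Epst Eneg x0 ω k))
    (hnear : ∀ ε : ℝ, 0 < ε → ∃ m, A - ε ≤ clusterLevel s (cproc α β A Epst Eneg x0 ω m)) :
    (∀ i, Tendsto (fun k => cproc α β A Epst Eneg x0 ω k i) atTop (nhds (s i * A))) ∨
      ∀ i, Tendsto (fun k => cproc α β A Epst Eneg x0 ω k i) atTop (nhds (-s i * A)) := by
  have : NeZero n := ⟨fun h0 => by subst h0; exact u.elim0⟩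
  simp only [le_clusterLevel_iff] at hnear
  obtain ⟨m, hm⟩ := hnear (A / 2) (by linarith)
  rw [sub_half] at hm
  rcases hm with hm | hm
  · exact Or.inl (h.tendsto_of_near hA hα0 hα1 hβ hX hnear hm)
  · refine Or.inr (h.neg_sign.tendsto_of_near hA hα0 hα1 hβ hX (fun ε hε => ?_) hm)
    obtain ⟨m, hm⟩ := hnear ε hε
    exact ⟨m, by rw [neg_neg]; exact hm.symm⟩

lemma reflTransGen_of_induce_connected {E : Finset (Sym2 (Fin n))} {V : Finset (Fin n)}
    (hE : ∀ i j, i ∈ V → j ∈ V → s(i, j) ∈ E → s(i, j) ∈ Epst)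
    (hV : ((graphOf E).induce (↑V : Set (Fin n))).Connected) {i j : Fin n} (hi : i ∈ V)
    (hj : j ∈ V) : Relation.ReflTransGen (fun a b => s(a, b) ∈ Epst) i j := by
  refine ((SimpleGraph.reachable_iff_reflTransGen _ _).mp
    (hV.preconnected ⟨i, hi⟩ ⟨j, hj⟩)).lift Subtype.val fun x y hxy => hE _ _ x.2 y.2 ?_
  simp only [SimpleGraph.comap_adj, graphOf, SimpleGraph.fromEdgeSet_adj] at hxy
  exact_mod_cast hxy.1

lemma exists_signedBalance (hdisj : Disjoint Epst Eneg) (hloop : ∀ e ∈ Epst ∪ Eneg, ¬ e.IsDiag)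
    (hneg : Eneg.Nonempty) {V1 V2 : Finset (Fin n)}
    (hVdisj : Disjoint V1 V2) (hVunion : V1 ∪ V2 = Finset.univ)
    (hbal1 : ∀ i j : Fin n, s(i, j) ∈ Epst ∪ Eneg →
      ((i ∈ V1 ∧ j ∈ V1) ∨ (i ∈ V2 ∧ j ∈ V2)) → s(i, j) ∈ Epst)
    (hbal2 : ∀ i j : Fin n, s(i, j) ∈ Epst ∪ Eneg →
      ((i ∈ V1 ∧ j ∈ V2) ∨ (i ∈ V2 ∧ j ∈ V1)) → s(i, j) ∈ Eneg)
    (hind1 : ((graphOf (Epst ∪ Eneg)).induce (↑V1 : Set (Fin n))).Connected)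
    (hind2 : ((graphOf (Epst ∪ Eneg)).induce (↑V2 : Set (Fin n))).Connected) :
    ∃ u w, SignedBalance Epst Eneg (fun i => if i ∈ V1 then 1 else -1) u w := by
  have hcover : ∀ i, i ∈ V1 ∨ i ∈ V2 := fun i => by
    rw [← Finset.mem_union, hVunion]
    exact Finset.mem_univ i
  have hV2 : ∀ i, i ∈ V2 ↔ i ∉ V1 := fun i =>
    ⟨fun h2 h1 => Finset.disjoint_left.mp hVdisj h1 h2, (hcover i).resolve_left⟩
  simp only [hV2] at hbal1 hbal2
  have hcross : ∀ i j, s(i, j) ∈ Eneg → (i ∈ V1 ↔ j ∉ V1) := fun i j hij => by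
    have := hbal1 i j (Finset.mem_union_right _ hij)
    have := Finset.disjoint_right.mp hdisj hij
    tauto
  obtain ⟨e, he⟩ := hneg
  obtain ⟨u, w, hu, hw, huw⟩ : ∃ u w, u ∈ V1 ∧ w ∈ V2 ∧ s(u, w) ∈ Eneg := by
    induction e with
    | h i j =>
      by_cases hi : i ∈ V1
      · exact ⟨i, j, hi, (hV2 j).mpr ((hcross i j he).mp hi), he⟩
      · exact ⟨j, i, by_contra fun hj => hi ((hcross i j he).mpr hj), (hV2 i).mpr hi,
          by rwa [Sym2.eq_swap]⟩
  refine ⟨u, w, fun i j hij hne => hloop _ hij hne, hdisj, fun i => by by_cases i ∈ V1 <;> simp [*],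
    fun i j hij => ?_, fun i j hij => ?_, huw, fun v => ?_⟩
  · have := hbal2 i j (Finset.mem_union_left _ hij)
    have := Finset.disjoint_left.mp hdisj hij
    have : i ∈ V1 ↔ j ∈ V1 := by tauto
    simp [this]
  · simp only [hcross i j hij]
    split_ifs <;> simp
  · rcases hcover v with hv | hv
    · exact Or.inl (reflTransGen_of_induce_connected
        (fun i j hi hj hij => hbal1 i j hij (Or.inl ⟨hi, hj⟩)) hind1 hu hv)
    · exact Or.inr (reflTransGen_of_induce_connected (fun i j hi hj hij =>
        hbal1 i j hij (Or.inr ⟨(hV2 i).mp hi, (hV2 j).mp hj⟩)) hind2 hw hv)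

end Limit

theorem boundary_clustering_strong_balance
    (n : ℕ) (hn : 3 ≤ n)
    (Epst Eneg : Finset (Sym2 (Fin n)))
    (hdisj : Disjoint Epst Eneg)
    (hloop : ∀ e ∈ Epst ∪ Eneg, ¬ e.IsDiag)
    (P : Matrix (Fin n) (Fin n) ℝ)
    (hP : RowStochastic P)
    (hPc : Complies P (Epst ∪ Eneg))
    (hconn : (graphOf (Epst ∪ Eneg)).Connected)
    (hneg : Eneg.Nonempty)
    (hpw : ∀ i j : Fin n, s(i, j) ∈ Epst ∪ Eneg → 0 < P i j + P j i)
    (V1 V2 : Finset (Fin n)) (hV1 : V1.Nonempty) (hV2 : V2.Nonempty)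
    (hVdisj : Disjoint V1 V2) (hVunion : V1 ∪ V2 = Finset.univ)
    (hbal1 : ∀ i j : Fin n, s(i, j) ∈ Epst ∪ Eneg →
      ((i ∈ V1 ∧ j ∈ V1) ∨ (i ∈ V2 ∧ j ∈ V2)) → s(i, j) ∈ Epst)
    (hbal2 : ∀ i j : Fin n, s(i, j) ∈ Epst ∪ Eneg →
      ((i ∈ V1 ∧ j ∈ V2) ∨ (i ∈ V2 ∧ j ∈ V1)) → s(i, j) ∈ Eneg)
    (hind1 : ((graphOf (Epst ∪ Eneg)).induce (↑V1 : Set (Fin n))).Connected)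
    (hind2 : ((graphOf (Epst ∪ Eneg)).induce (↑V2 : Set (Fin n))).Connected)
    (α : ℝ) (hα0 : 0 < α) (hα1 : α < 1) (hαhalf : α ≠ 1 / 2)
    (A : ℝ) (hA : 0 < A)
    (a b c : ℝ) (ha : 0 < a) (hb : 0 < b) (hc : 0 < c) (habc : a + b + c = 1)
    (ℙ : Measure (ℕ → Sel2 n)) [IsProbabilityMeasure ℙ]
    (hiid : IsIIDSel2 ℙ P (Epst ∪ Eneg) a b c) :
    ∃ β0 : ℝ, 0 < β0 ∧ ∀ β : ℝ, β0 < β →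
      ∀ x0 : Fin n → ℝ, (∀ i, x0 i ∈ Set.Icc (-A) A) → 0 < diam x0 →
        ∃ B1 B2 : (ℕ → Sel2 n) → ℝ,
          (∀ ω, B1 ω = A ∨ B1 ω = -A) ∧ (∀ ω, B2 ω = A ∨ B2 ω = -A) ∧
          ℙ {ω | (∀ i ∈ V1,
              Tendsto (fun k : ℕ => cproc α β A Epst Eneg x0 ω k i) atTop (nhds (B1 ω))) ∧
            (∀ i ∈ V2,
              Tendsto (fun k : ℕ => cproc α β A Epst Eneg x0 ω k i) atTop (nhds (B2 ω)))} = 1 ∧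
          ℙ {ω | B1 ω + B2 ω = 0} = 1 := by
  classical
  obtain ⟨u, w, h⟩ := exists_signedBalance hdisj hloop hneg hVdisj hVunion hbal1 hbal2 hind1 hind2
  set s : Fin n → ℝ := fun i => if i ∈ V1 then 1 else -1
  have hs1 : ∀ i ∈ V1, s i = 1 := fun i hi => if_pos hi
  have hs2 : ∀ i ∈ V2, s i = -1 := fun i hi => if_neg (Finset.disjoint_right.mp hVdisj hi)
  obtain ⟨p, hp, hp1, hpq⟩ := exists_pos_le_of_forall_pos (supp := IsUpd Epst Eneg)
    (q := fun l => (seldist2 P (Epst ∪ Eneg) a b c l).toReal) (by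
      rintro _ ⟨i, j, hij, rfl⟩
      exact seldist2_upd_pos hij (h.ne i j hij) (hpw i j hij) ha hb)
  obtain ⟨β0, hβ0, hβ⟩ := h.exists_decay hA hα0 hα1 hαhalf
    (fun l => ENNReal.toReal_nonneg) hiid.sum_toReal hp hp1 hpq
  refine ⟨β0, hβ0, fun β hβlt x0 hx0 hd0 => ?_⟩
  obtain ⟨hβ', r, T, ρ, hr, hρ0, hρ1, hdecay⟩ := hβ β hβlt
  set up : (ℕ → Sel2 n) → Prop := fun ω => ∀ i ∈ V1,
    Tendsto (fun k : ℕ => cproc α β A Epst Eneg x0 ω k i) atTop (nhds A)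
  refine ⟨fun ω => if up ω then A else -A, fun ω => -(if up ω then A else -A), fun ω => ?_,
    fun ω => ?_, ?_, by simp⟩
  · by_cases hu : up ω <;> simp [hu]
  · by_cases hu : up ω <;> simp [hu]
  rw [← measure_univ (μ := ℙ)]
  refine measure_congr (eventuallyEq_univ.mpr ?_)
  filter_upwards [h.ae_exists_near hA hα0 hα1 hαhalf hβ' hr hρ0 hρ1 hiid hx0 hd0
    fun k => hdecay k x0 hx0 hd0] with ω hω
  have hX := cproc_invariant (β := β) (x0 := x0) (I := InBox A)
    (fun l x hx => InBox.cstep hA.le hdisj h.ne hα0.le hα1.le hx l) hx0 ω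
  rcases h.tendsto_or hA hα0.le hα1.le hβ' hX hω with hlim | hlim
  · have hup : up ω := fun i hi => by simpa [hs1 i hi] using hlim i
    simp only [hup, if_true]
    exact ⟨hup, fun i hi => by simpa [hs2 i hi] using hlim i⟩
  · have hup : ¬up ω := fun hup => by
      obtain ⟨i, hi⟩ := hV1
      have := tendsto_nhds_unique (hup i hi) (hlim i)
      rw [hs1 i hi] at this
      linarith
    simp only [hup, if_false, neg_neg]
    exact ⟨fun i hi => by simpa [hs1 i hi] using hlim i,
      fun i hi => by simpa [hs2 i hi] using hlim i⟩

end SignedOpinion
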